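/- arXiv:2006.05973 — 4 statements merged into one kernel-verified Lean document; each statement's English description precedes it below -/
import Mathlib

section
/- Let ν be a nonzero finite nonnegative measure and μ a finite nonnegative measure on (Ω,F). Then D_φ(μ‖ν) = sup{ ∫ g dμ − ∫ φ*(g) dν : g : Ω → ℝ bounded measurable with φ'(−∞) ≤ g(ω) ≤ φ'(∞) for every ω ∈ Ω }, where φ*(y) := sup_{x∈ℝ} (x·y − φ(x)) is the convex conjugate of φ. (This is the variational/biconjugate representation of the φ-divergence for the decomposable pair consisting of all finite signed measures and all bounded measurable functions, restricted to nonnegative μ.) -/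
open MeasureTheory Filter Set
open scoped ENNReal NNReal Topology

/-- Map an extended real to `ℝ≥0∞`, sending `⊤` to `⊤` and negative values to `0`. -/
noncomputable def erealToENNReal (x : EReal) : ℝ≥0∞ :=
  if x = ⊤ then ⊤ else ENNReal.ofReal x.toReal

/-- The extended integral of an `EReal`-valued function: the (Lebesgue) integral of the
positive part minus the integral of the negative part. -/
noncomputable def eIntegral {Ω : Type*} [MeasurableSpace Ω] (ν : Measure Ω)
    (f : Ω → EReal) : EReal :=
  ((∫⁻ ω, erealToENNReal (f ω) ∂ν : ℝ≥0∞) : EReal) -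
    ((∫⁻ ω, erealToENNReal (-f ω) ∂ν : ℝ≥0∞) : EReal)

/-- The φ-divergence `D_φ(μ‖ν) = ∫ φ(dμ_c/dν) dν + φ'(∞)·μ_s(Ω)` for a nonnegative finite
measure `μ` with Lebesgue decomposition `μ = μ_c + μ_s` with respect to `ν`, where
`dphi = φ'(∞)`.  (The convention `0·(±∞) = 0` is built into `EReal` multiplication.) -/
noncomputable def divE {Ω : Type*} [MeasurableSpace Ω] (φ : ℝ → EReal) (dphi : EReal)
    (μ ν : Measure Ω) : EReal :=
  eIntegral ν (fun ω => φ ((μ.rnDeriv ν ω).toReal)) +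
    dphi * ((μ.singularPart ν Set.univ : ℝ≥0∞) : EReal)

/-- The convex conjugate `φ*(y) = sup_{x ∈ ℝ} (x·y − φ(x))`. -/
noncomputable def phiStarE (φ : ℝ → EReal) (y : ℝ) : EReal :=
  ⨆ x : ℝ, ((x * y : ℝ) : EReal) - φ x


theorem exists_sep (φ : ℝ → EReal)
    (hconv : ∀ x y a b : ℝ, 0 ≤ a → 0 ≤ b → a + b = 1 →
      φ (a * x + b * y) ≤ (a : EReal) * φ x + (b : EReal) * φ y)
    (hlsc : LowerSemicontinuous φ) (hone : φ 1 = 0) (x₀ t₀ : ℝ) (h : (t₀ : EReal) < φ x₀) :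
    ∃ α β u : ℝ, 0 ≤ β ∧ α * x₀ + β * t₀ < u ∧
      ∀ x t : ℝ, φ x ≤ (t : EReal) → u < α * x + β * t := by
  set E : Set (ℝ × ℝ) := {p | φ p.1 ≤ (p.2 : EReal)} with hE
  have hcl : IsClosed E := by
    have h1 := hlsc.isClosed_epigraph
    have h2 : Continuous (fun p : ℝ × ℝ => ((p.1, (p.2 : EReal)) : ℝ × EReal)) := by
      exact continuous_fst.prodMk (continuous_coe_real_ereal.comp continuous_snd)
    exact h1.preimage h2
  have hcx : Convex ℝ E := by
    intro p hp q hq a b ha hb hab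
    have h1 := hconv p.1 q.1 a b ha hb hab
    change φ (a * p.1 + b * q.1) ≤ ((a * p.2 + b * q.2 : ℝ) : EReal)
    refine h1.trans ?_
    rw [EReal.coe_add, EReal.coe_mul, EReal.coe_mul]
    exact add_le_add (mul_le_mul_of_nonneg_left hp (by exact_mod_cast ha))
      (mul_le_mul_of_nonneg_left hq (by exact_mod_cast hb))
  have hnot : ((x₀, t₀) : ℝ × ℝ) ∉ E := by
    simpa [hE] using h
  obtain ⟨f, u, hf1, hf2⟩ := geometric_hahn_banach_point_closed hcx hcl hnot
  have hlin : ∀ x t : ℝ, f (x, t) = f (1, 0) * x + f (0, 1) * t := by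
    intro x t
    have : ((x, t) : ℝ × ℝ) = x • ((1, 0) : ℝ × ℝ) + t • ((0, 1) : ℝ × ℝ) := by
      ext <;> simp
    rw [this, map_add, map_smul, map_smul]
    simp only [smul_eq_mul]; ring
  have hall : ∀ x t : ℝ, φ x ≤ (t : EReal) → u < f (1, 0) * x + f (0, 1) * t := by
    intro x t hx
    rw [← hlin]; exact hf2 _ hx
  refine ⟨f (1, 0), f (0, 1), u, ?_, ?_, hall⟩
  · by_contra hneg
    push Not at hneg
    set β := f (0, 1)
    set α := f (1, 0)
    have := hall 1 (max 0 ((u - α) / β)) (by rw [hone]; exact_mod_cast le_max_left _ _)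
    have h3 : β * max 0 ((u - α) / β) ≤ β * ((u - α) / β) :=
      mul_le_mul_of_nonpos_left (le_max_right _ _) hneg.le
    rw [mul_div_cancel₀ _ hneg.ne] at h3
    linarith
  · rw [← hlin]; exact hf1

theorem minorant_of_sep (φ : ℝ → EReal) (hbot : ∀ x : ℝ, φ x ≠ ⊥) (α β u : ℝ) (hβ : 0 < β)
    (h : ∀ x t : ℝ, φ x ≤ (t : EReal) → u < α * x + β * t) (x : ℝ) :
    (((-α / β) * x - (-u / β) : ℝ) : EReal) ≤ φ x := by
  induction hx : φ x with
  | bot => exact absurd hx (hbot x)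
  | top => exact le_top
  | coe t =>
    have := h x t hx.le
    rw [EReal.coe_le_coe_iff]
    have h2 : -α / β * x - -u / β = (u - α * x) / β := by ring
    rw [h2, div_le_iff₀ hβ]; linarith

theorem exists_minorant (φ : ℝ → EReal) (hbot : ∀ x : ℝ, φ x ≠ ⊥)
    (hconv : ∀ x y a b : ℝ, 0 ≤ a → 0 ≤ b → a + b = 1 →
      φ (a * x + b * y) ≤ (a : EReal) * φ x + (b : EReal) * φ y)
    (hlsc : LowerSemicontinuous φ) (hone : φ 1 = 0) (x₀ t₀ : ℝ) (h : (t₀ : EReal) < φ x₀) :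
    ∃ y c : ℝ, (∀ x : ℝ, ((y * x - c : ℝ) : EReal) ≤ φ x) ∧ t₀ < y * x₀ - c := by
  have base : ∃ y c : ℝ, (∀ x : ℝ, ((y * x - c : ℝ) : EReal) ≤ φ x) := by
    obtain ⟨α, β, u, hβ, h1, h2⟩ := exists_sep φ hconv hlsc hone 1 (-1)
      (by rw [hone]; exact_mod_cast (by norm_num : (-1 : ℝ) < 0))
    have h3 := h2 1 0 (by rw [hone]; simp)
    have hβ' : 0 < β := by nlinarith
    exact ⟨_, _, minorant_of_sep φ hbot α β u hβ' h2⟩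
  obtain ⟨α, β, u, hβ, h1, h2⟩ := exists_sep φ hconv hlsc hone x₀ t₀ h
  rcases hβ.lt_or_eq with hβ' | rfl
  · refine ⟨_, _, minorant_of_sep φ hbot α β u hβ' h2, ?_⟩
    have h2 : -α / β * x₀ - -u / β = (u - α * x₀) / β := by ring
    rw [h2, lt_div_iff₀ hβ']; linarith
  · obtain ⟨y, c, hyc⟩ := base
    have hpos : 0 < u - α * x₀ := by linarith
    obtain ⟨k, hk⟩ := exists_nat_gt ((t₀ - (y * x₀ - c)) / (u - α * x₀))
    rw [div_lt_iff₀ hpos] at hk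
    refine ⟨y - k * α, c - k * u, ?_, by linarith⟩
    intro x
    induction hx : φ x with
    | bot => exact absurd hx (hbot x)
    | top => exact le_top
    | coe t =>
      have h3 := h2 x t hx.le
      have h4 := hyc x
      rw [hx, EReal.coe_le_coe_iff] at h4
      rw [EReal.coe_le_coe_iff]
      have : (k : ℝ) * (u - α * x) ≤ 0 :=
        mul_nonpos_of_nonneg_of_nonpos (Nat.cast_nonneg k) (by linarith)
      linarith

theorem exists_seq (φ : ℝ → EReal) (hbot : ∀ x : ℝ, φ x ≠ ⊥)
    (hconv : ∀ x y a b : ℝ, 0 ≤ a → 0 ≤ b → a + b = 1 →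
      φ (a * x + b * y) ≤ (a : EReal) * φ x + (b : EReal) * φ y)
    (hlsc : LowerSemicontinuous φ) (hone : φ 1 = 0) :
    ∃ y c : ℕ → ℝ, (∀ n, ∀ x : ℝ, ((y n * x - c n : ℝ) : EReal) ≤ φ x) ∧
      ∀ x t : ℝ, (t : EReal) < φ x → ∃ n, t < y n * x - c n := by
  set M : Set (ℝ × ℝ) := {p | ∀ x : ℝ, ((p.1 * x - p.2 : ℝ) : EReal) ≤ φ x}
  have hne : Nonempty M := by
    obtain ⟨y, c, h, -⟩ := exists_minorant φ hbot hconv hlsc hone 1 (-1)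
      (by rw [hone]; exact_mod_cast (by norm_num : (-1 : ℝ) < 0))
    exact ⟨⟨(y, c), h⟩⟩
  let s := TopologicalSpace.denseSeq M
  refine ⟨fun n => (s n).1.1, fun n => (s n).1.2, fun n => (s n).2, ?_⟩
  intro x t hxt
  obtain ⟨y, c, h, h'⟩ := exists_minorant φ hbot hconv hlsc hone x t hxt
  have ho : IsOpen {p : M | t < p.1.1 * x - p.1.2} := by
    apply isOpen_lt <;> fun_prop
  obtain ⟨n, hn⟩ := (TopologicalSpace.denseRange_denseSeq M).exists_mem_open ho ⟨⟨(y, c), h⟩, h'⟩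
  exact ⟨n, hn⟩

theorem slope_bounds (φ : ℝ → EReal) (dpos dneg : EReal)
    (hdpos : Tendsto (fun x : ℝ => φ x * ((x⁻¹ : ℝ) : EReal)) atTop (𝓝 dpos))
    (hdneg : Tendsto (fun x : ℝ => φ x * ((x⁻¹ : ℝ) : EReal)) atBot (𝓝 dneg))
    (y c : ℝ) (h : ∀ x : ℝ, ((y * x - c : ℝ) : EReal) ≤ φ x) :
    dneg ≤ (y : EReal) ∧ (y : EReal) ≤ dpos := by
  constructor
  · have h1 : Tendsto (fun x : ℝ => ((y - c * x⁻¹ : ℝ) : EReal)) atBot (𝓝 (y : EReal)) := by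
      have : Tendsto (fun x : ℝ => y - c * x⁻¹) atBot (𝓝 (y - c * 0)) :=
        tendsto_const_nhds.sub (tendsto_inv_atBot_zero.const_mul c)
      simp only [mul_zero, sub_zero] at this
      exact (continuous_coe_real_ereal.tendsto y).comp this
    refine le_of_tendsto_of_tendsto hdneg h1 ?_
    filter_upwards [eventually_lt_atBot 0] with x hx
    have h2 : ((y - c * x⁻¹ : ℝ) : EReal) = ((y * x - c : ℝ) : EReal) * ((x⁻¹ : ℝ) : EReal) := by
      rw [← EReal.coe_mul]; congr 1; have := hx.ne; field_simp
    rw [h2]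
    have := EReal.mul_le_mul_of_nonpos_right (h x) (c := ((x⁻¹ : ℝ) : EReal)) (by
      exact_mod_cast (inv_neg''.2 hx).le)
    exact this
  · have h1 : Tendsto (fun x : ℝ => ((y - c * x⁻¹ : ℝ) : EReal)) atTop (𝓝 (y : EReal)) := by
      have : Tendsto (fun x : ℝ => y - c * x⁻¹) atTop (𝓝 (y - c * 0)) :=
        tendsto_const_nhds.sub (tendsto_inv_atTop_zero.const_mul c)
      simp only [mul_zero, sub_zero] at this
      exact (continuous_coe_real_ereal.tendsto y).comp this
    refine le_of_tendsto_of_tendsto h1 hdpos ?_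
    filter_upwards [eventually_gt_atTop 0] with x hx
    have h2 : ((y - c * x⁻¹ : ℝ) : EReal) = ((y * x - c : ℝ) : EReal) * ((x⁻¹ : ℝ) : EReal) := by
      rw [← EReal.coe_mul]; congr 1; field_simp
    rw [h2]
    exact mul_le_mul_of_nonneg_right (h x) (by exact_mod_cast (inv_pos.2 hx).le)

/-- Running argmax of affine functions `y n * x - c n`. -/
noncomputable def runMax (y c : ℕ → ℝ) : ℕ → ℝ → ℝ × ℝ
  | 0, _ => (y 0, c 0)
  | n + 1, x => if (runMax y c n x).1 * x - (runMax y c n x).2 < y (n + 1) * x - c (n + 1)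
      then (y (n + 1), c (n + 1)) else runMax y c n x

theorem runMax_measurable (y c : ℕ → ℝ) (n : ℕ) : Measurable (runMax y c n) := by
  induction n with
  | zero => exact measurable_const
  | succ n ih =>
    have : runMax y c (n + 1) = fun x => if (runMax y c n x).1 * x - (runMax y c n x).2 <
        y (n + 1) * x - c (n + 1) then (y (n + 1), c (n + 1)) else runMax y c n x := rfl
    rw [this]
    refine Measurable.ite (measurableSet_lt ?_ ?_) measurable_const ih
    · exact (ih.fst.mul measurable_id).sub ih.snd
    · fun_prop

theorem runMax_mem (y c : ℕ → ℝ) (n : ℕ) (x : ℝ) : ∃ k ≤ n, runMax y c n x = (y k, c k) := by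
  induction n with
  | zero => exact ⟨0, le_rfl, rfl⟩
  | succ n ih =>
    rw [runMax]
    split_ifs
    · exact ⟨n + 1, le_rfl, rfl⟩
    · obtain ⟨k, hk, h⟩ := ih
      exact ⟨k, by omega, h⟩

theorem runMax_bdd (y c : ℕ → ℝ) (n : ℕ) :
    ∃ C : ℝ, ∀ x, |(runMax y c n x).1| ≤ C ∧ |(runMax y c n x).2| ≤ C := by
  refine ⟨∑ k ∈ Finset.range (n + 1), (|y k| + |c k|), fun x => ?_⟩
  obtain ⟨k, hk, h⟩ := runMax_mem y c n x
  have := Finset.single_le_sum (f := fun k => |y k| + |c k|) (fun i _ => by positivity)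
    (Finset.mem_range.2 (Nat.lt_succ_of_le hk))
  rw [h]
  simp only at this ⊢
  constructor <;> linarith [abs_nonneg (y k), abs_nonneg (c k)]

theorem runMax_mono (y c : ℕ → ℝ) (x : ℝ) :
    Monotone (fun n => (runMax y c n x).1 * x - (runMax y c n x).2) := by
  refine monotone_nat_of_le_succ fun n => ?_
  conv_rhs => rw [runMax]
  split_ifs with h
  · exact h.le
  · exact le_rfl

theorem runMax_ge (y c : ℕ → ℝ) (x : ℝ) (n : ℕ) :
    y n * x - c n ≤ (runMax y c n x).1 * x - (runMax y c n x).2 := by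
  cases n with
  | zero => exact le_rfl
  | succ n =>
    rw [runMax]
    split_ifs with h
    · exact le_rfl
    · exact not_lt.1 h

theorem erealToENNReal_eq (x : EReal) : erealToENNReal x = x.toENNReal := by
  unfold erealToENNReal EReal.toENNReal
  split_ifs <;> rfl

theorem pointwise_split (f : EReal) (l : ℝ) (h : (l : EReal) ≤ f) :
    f.toENNReal + ENNReal.ofReal (-l) =
      (f - l).toENNReal + ENNReal.ofReal l + (-f).toENNReal := by
  induction f with
  | bot => simp at h
  | top => simp
  | coe a =>
    rw [EReal.coe_le_coe_iff] at h
    rw [← EReal.coe_sub, ← EReal.coe_neg]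
    simp only [EReal.real_coe_toENNReal]
    rcases le_total 0 l with hl | hl
    · have ha : 0 ≤ a := hl.trans h
      rw [ENNReal.ofReal_of_nonpos (neg_nonpos.2 hl), ENNReal.ofReal_of_nonpos (neg_nonpos.2 ha),
        ← ENNReal.ofReal_add (by linarith) hl]
      simp
    · rcases le_total 0 a with ha | ha
      · rw [ENNReal.ofReal_of_nonpos hl, ENNReal.ofReal_of_nonpos (neg_nonpos.2 ha),
          ← ENNReal.ofReal_add (by linarith) (by linarith)]
        simp [sub_eq_add_neg]
      · rw [ENNReal.ofReal_of_nonpos hl, ENNReal.ofReal_of_nonpos ha, add_zero, zero_add,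
          ← ENNReal.ofReal_add (by linarith) (by linarith)]
        congr 1; ring

theorem rearr (A B N P Q : ℝ≥0∞) (hN : N ≠ ⊤) (hP : P ≠ ⊤) (hQ : Q ≠ ⊤)
    (h : A + N = B + P + Q) :
    (A : EReal) - (Q : EReal) = (B : EReal) + ((P.toReal - N.toReal : ℝ) : EReal) := by
  lift N to ℝ≥0 using hN
  lift P to ℝ≥0 using hP
  lift Q to ℝ≥0 using hQ
  have hQ' : ((Q : ℝ≥0∞) : EReal) = ((Q : ℝ) : EReal) := rfl
  rw [hQ']
  by_cases hA : A = ⊤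
  · have hB : B = ⊤ := by
      by_contra hB
      lift B to ℝ≥0 using hB
      rw [hA, top_add] at h
      exact absurd h (by exact_mod_cast ENNReal.top_ne_coe)
    rw [hA, hB]
    simp only [EReal.coe_ennreal_top]
    rw [EReal.top_add_coe, EReal.top_sub_coe]
  · have hB : B ≠ ⊤ := by
      rintro rfl
      rw [top_add, top_add] at h
      lift A to ℝ≥0 using hA
      exact absurd h (by exact_mod_cast ENNReal.coe_ne_top)
    lift A to ℝ≥0 using hA
    lift B to ℝ≥0 using hB
    have h' : (A : ℝ) + N = B + P + Q := by exact_mod_cast h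
    have hA' : ((A : ℝ≥0∞) : EReal) = ((A : ℝ) : EReal) := rfl
    have hB' : ((B : ℝ≥0∞) : EReal) = ((B : ℝ) : EReal) := rfl
    rw [hA', hB', ← EReal.coe_sub, ← EReal.coe_add]
    congr 1
    simp only [ENNReal.coe_toReal]
    linarith

theorem eIntegral_eq {Ω : Type*} [MeasurableSpace Ω] (ν : Measure Ω) (f : Ω → EReal)
    (hf : Measurable f) (l : Ω → ℝ) (hl : Integrable l ν) (hlm : Measurable l)
    (hle : ∀ ω, (l ω : EReal) ≤ f ω) :
    eIntegral ν f = ((∫⁻ ω, (f ω - (l ω : EReal)).toENNReal ∂ν : ℝ≥0∞) : EReal) +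
      ((∫ ω, l ω ∂ν : ℝ) : EReal) := by
  unfold eIntegral
  simp only [erealToENNReal_eq]
  rw [integral_eq_lintegral_pos_part_sub_lintegral_neg_part hl]
  have hN : ∫⁻ ω, ENNReal.ofReal (-l ω) ∂ν ≠ ⊤ := hl.neg.lintegral_lt_top.ne
  refine rearr _ _ _ _ _ hN hl.lintegral_lt_top.ne ?_ ?_
  · refine ne_top_of_le_ne_top hN (lintegral_mono fun ω => ?_)
    have : -f ω ≤ ((-l ω : ℝ) : EReal) := by
      rw [EReal.coe_neg]; exact EReal.neg_le_neg_iff.2 (hle ω)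
    exact EReal.toENNReal_le_toENNReal this
  · have m1 : Measurable fun ω => ENNReal.ofReal (-l ω) := hlm.neg.ennreal_ofReal
    have m2 : Measurable fun ω => ENNReal.ofReal (l ω) := hlm.ennreal_ofReal
    have m3 : Measurable fun ω => (-f ω).toENNReal := hf.neg.ereal_toENNReal
    rw [← lintegral_add_right _ m1, ← lintegral_add_right _ m2, ← lintegral_add_right _ m3]
    exact lintegral_congr fun ω => pointwise_split _ _ (hle ω)

theorem eIntegral_coe {Ω : Type*} [MeasurableSpace Ω] (ν : Measure Ω)
    (l : Ω → ℝ) (hl : Integrable l ν) :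
    eIntegral ν (fun ω => (l ω : EReal)) = ((∫ ω, l ω ∂ν : ℝ) : EReal) := by
  unfold eIntegral
  simp only [erealToENNReal_eq]
  rw [integral_eq_lintegral_pos_part_sub_lintegral_neg_part hl]
  have h1 : ∫⁻ ω, ENNReal.ofReal (l ω) ∂ν ≠ ⊤ := hl.lintegral_lt_top.ne
  have hN : ∫⁻ ω, ENNReal.ofReal (-l ω) ∂ν ≠ ⊤ := hl.neg.lintegral_lt_top.ne
  have := rearr (∫⁻ ω, ENNReal.ofReal (l ω) ∂ν) 0 (∫⁻ ω, ENNReal.ofReal (-l ω) ∂ν)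
    (∫⁻ ω, ENNReal.ofReal (l ω) ∂ν) (∫⁻ ω, ENNReal.ofReal (-l ω) ∂ν) hN h1 hN (by simp)
  simpa [← EReal.coe_neg] using this

theorem eIntegral_mono_ae {Ω : Type*} [MeasurableSpace Ω] (ν : Measure Ω) (f g : Ω → EReal)
    (h : ∀ᵐ ω ∂ν, f ω ≤ g ω) : eIntegral ν f ≤ eIntegral ν g := by
  unfold eIntegral
  simp only [erealToENNReal_eq]
  refine EReal.sub_le_sub ?_ ?_
  · refine EReal.coe_ennreal_le_coe_ennreal_iff.2 (lintegral_mono_ae ?_)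
    filter_upwards [h] with ω hω
    exact EReal.toENNReal_le_toENNReal hω
  · refine EReal.coe_ennreal_le_coe_ennreal_iff.2 (lintegral_mono_ae ?_)
    filter_upwards [h] with ω hω
    exact EReal.toENNReal_le_toENNReal (EReal.neg_le_neg_iff.2 hω)

theorem integral_decomp {Ω : Type*} [MeasurableSpace Ω] (μ ν : Measure Ω) [IsFiniteMeasure μ]
    [IsFiniteMeasure ν] (g : Ω → ℝ) (hg : Integrable g μ) :
    Integrable (fun ω => (μ.rnDeriv ν ω).toReal * g ω) ν ∧
    ∫ ω, g ω ∂μ = ∫ ω, g ω ∂(μ.singularPart ν) + ∫ ω, (μ.rnDeriv ν ω).toReal * g ω ∂ν := by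
  have hdec := Measure.haveLebesgueDecomposition_add μ ν
  have hg' := hg
  rw [hdec, integrable_add_measure] at hg'
  constructor
  · have := (integrable_withDensity_iff_integrable_smul' (Measure.measurable_rnDeriv μ ν)
      (Measure.rnDeriv_lt_top μ ν)).1 hg'.2
    simpa using this
  · conv_lhs => rw [hdec]
    rw [integral_add_measure hg'.1 hg'.2,
      integral_withDensity_eq_integral_toReal_smul (Measure.measurable_rnDeriv μ ν)
        (Measure.rnDeriv_lt_top μ ν)]
    simp

theorem phiStar_measurable (φ : ℝ → EReal) : Measurable (phiStarE φ) := by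
  have : LowerSemicontinuous (phiStarE φ) := by
    unfold phiStarE
    refine lowerSemicontinuous_iSup fun x => Continuous.lowerSemicontinuous ?_
    induction φ x with
    | bot => simp only [EReal.coe_sub_bot]; exact continuous_const
    | top => simp only [EReal.sub_top]; exact continuous_const
    | coe a =>
      simp only [← EReal.coe_sub]
      exact continuous_coe_real_ereal.comp (by fun_prop)
  exact this.measurable

theorem le_phiStar (φ : ℝ → EReal) (hone : φ 1 = 0) (y : ℝ) : (y : EReal) ≤ phiStarE φ y := by
  have := le_iSup (fun x : ℝ => ((x * y : ℝ) : EReal) - φ x) 1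
  rw [hone, one_mul, sub_zero] at this
  exact this

theorem phiStar_le (φ : ℝ → EReal) (y c : ℝ) (h : ∀ x : ℝ, ((y * x - c : ℝ) : EReal) ≤ φ x) :
    phiStarE φ y ≤ (c : EReal) := by
  refine iSup_le fun x => ?_
  refine EReal.sub_le_of_le_add ?_
  calc ((x * y : ℝ) : EReal) = (c : EReal) + ((y * x - c : ℝ) : EReal) := by
        rw [← EReal.coe_add]; congr 1; ring
    _ ≤ _ := by gcongr; exact h x

theorem young (φ : ℝ → EReal) (hbot : ∀ x : ℝ, φ x ≠ ⊥) (x y a b : ℝ)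
    (hb : (b : EReal) ≤ phiStarE φ y) :
    ENNReal.ofReal (x * y - a - b) ≤
      (φ x - (a : EReal)).toENNReal + (phiStarE φ y - (b : EReal)).toENNReal := by
  have h := le_iSup (fun x : ℝ => ((x * y : ℝ) : EReal) - φ x) x
  change _ ≤ phiStarE φ y at h
  refine le_trans ?_ EReal.toENNReal_add_le
  rw [← EReal.real_coe_toENNReal]
  apply EReal.toENNReal_le_toENNReal
  induction hx : φ x with
  | bot => exact absurd hx (hbot x)
  | top =>
    rw [EReal.top_sub_coe]
    induction hs : phiStarE φ y with
    | bot => rw [hs] at hb; simp at hb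
    | top => simp
    | coe s => rw [← EReal.coe_sub, EReal.top_add_coe]; exact le_top
  | coe t =>
    induction hs : phiStarE φ y with
    | bot => rw [hs] at hb; simp at hb
    | top => rw [EReal.top_sub_coe, ← EReal.coe_sub, EReal.coe_add_top]; exact le_top
    | coe s =>
      simp only [hs, hx] at h
      rw [← EReal.coe_sub, EReal.coe_le_coe_iff] at h
      rw [← EReal.coe_sub, ← EReal.coe_sub, ← EReal.coe_add, EReal.coe_le_coe_iff]
      linarith

theorem ofReal_integral_le {Ω : Type*} [MeasurableSpace Ω] (ν : Measure Ω) (f : Ω → ℝ)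
    (hf : Integrable f ν) : ENNReal.ofReal (∫ ω, f ω ∂ν) ≤ ∫⁻ ω, ENNReal.ofReal (f ω) ∂ν := by
  rw [integral_eq_lintegral_pos_part_sub_lintegral_neg_part hf]
  refine (ENNReal.ofReal_le_ofReal (sub_le_self _ ENNReal.toReal_nonneg)).trans ?_
  exact ENNReal.ofReal_toReal_le

theorem upper_bound {Ω : Type*} [MeasurableSpace Ω] (φ : ℝ → EReal)
    (hbot : ∀ x : ℝ, φ x ≠ ⊥) (hlsc : LowerSemicontinuous φ) (hone : φ 1 = 0) (dpos : EReal)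
    (μ ν : Measure Ω) [IsFiniteMeasure μ] [IsFiniteMeasure ν]
    (y₀ c₀ : ℝ) (hyc : ∀ x : ℝ, ((y₀ * x - c₀ : ℝ) : EReal) ≤ φ x) (hyd : (y₀ : EReal) ≤ dpos)
    (g : Ω → ℝ) (hg : Measurable g) (C : ℝ) (hC : ∀ ω, |g ω| ≤ C)
    (hgd : ∀ ω, (g ω : EReal) ≤ dpos) :
    ((∫ ω, g ω ∂μ : ℝ) : EReal) - eIntegral ν (fun ω => phiStarE φ (g ω)) ≤ divE φ dpos μ ν := by
  have hgint : ∀ ρ : Measure Ω, IsFiniteMeasure ρ → Integrable g ρ := fun ρ _ =>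
    Integrable.of_bound hg.aestronglyMeasurable C (Eventually.of_forall hC)
  obtain ⟨hi, hdec⟩ := integral_decomp μ ν g (hgint μ inferInstance)
  have hrm : Measurable fun ω => (μ.rnDeriv ν ω).toReal :=
    (Measure.measurable_rnDeriv μ ν).ennreal_toReal
  have hri : Integrable (fun ω => (μ.rnDeriv ν ω).toReal) ν := Measure.integrable_toReal_rnDeriv
  set r : Ω → ℝ := fun ω => (μ.rnDeriv ν ω).toReal with hr
  have hli : Integrable (fun ω => y₀ * r ω - c₀) ν := (hri.const_mul y₀).sub (integrable_const c₀)
  have hE := eIntegral_eq ν (fun ω => φ (r ω)) (hlsc.measurable.comp hrm) (fun ω => y₀ * r ω - c₀)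
    hli (by fun_prop) (fun ω => hyc _)
  have hP := eIntegral_eq ν (fun ω => phiStarE φ (g ω)) ((phiStar_measurable φ).comp hg) g
    (hgint ν inferInstance) hg (fun ω => le_phiStar φ hone _)
  have hsing : ((∫ ω, g ω ∂(μ.singularPart ν) : ℝ) : EReal) ≤
      dpos * ((μ.singularPart ν Set.univ : ℝ≥0∞) : EReal) := by
    have hfin : μ.singularPart ν Set.univ ≠ ⊤ := measure_ne_top _ _
    induction dpos with
    | bot => simp at hyd
    | coe d =>
      have h1 : ∫ ω, g ω ∂(μ.singularPart ν) ≤ ∫ _, d ∂(μ.singularPart ν) :=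
        integral_mono (hgint _ inferInstance) (integrable_const d)
          (fun ω => EReal.coe_le_coe_iff.1 (hgd ω))
      rw [integral_const, smul_eq_mul, measureReal_def] at h1
      rw [← EReal.coe_ennreal_toReal hfin, ← EReal.coe_mul, EReal.coe_le_coe_iff]
      linarith
    | top =>
      by_cases h0 : μ.singularPart ν Set.univ = 0
      · rw [Measure.measure_univ_eq_zero.1 h0]; simp
      · rw [EReal.top_mul_of_pos]
        · exact le_top
        · exact_mod_cast pos_iff_ne_zero.2 h0
  have key : ((∫ ω, r ω * g ω ∂ν : ℝ) : EReal) ≤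
      eIntegral ν (fun ω => φ (r ω)) + eIntegral ν (fun ω => phiStarE φ (g ω)) := by
    rw [hE, hP]
    have h1 : ENNReal.ofReal (∫ ω, (r ω * g ω - (y₀ * r ω - c₀) - g ω) ∂ν) ≤
        (∫⁻ ω, (φ (r ω) - ((y₀ * r ω - c₀ : ℝ) : EReal)).toENNReal ∂ν) +
        (∫⁻ ω, (phiStarE φ (g ω) - (g ω : EReal)).toENNReal ∂ν) := by
      rw [← lintegral_add_right _ (by
        apply Measurable.ereal_toENNReal
        exact ((phiStar_measurable φ).comp hg).sub hg.coe_real_ereal)]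
      refine (ofReal_integral_le _ _ ?_).trans (lintegral_mono fun ω => ?_)
      · exact (hi.sub hli).sub (hgint ν inferInstance)
      · exact young φ hbot _ _ _ _ (le_phiStar φ hone _)
    have h2 : ∫ ω, (r ω * g ω - (y₀ * r ω - c₀) - g ω) ∂ν =
        ∫ ω, r ω * g ω ∂ν - ∫ ω, (y₀ * r ω - c₀) ∂ν - ∫ ω, g ω ∂ν := by
      have e1 := integral_sub (hi.sub hli) (hgint ν inferInstance)
      have e2 := integral_sub hi hli
      simp only [Pi.sub_apply] at e1
      rw [e1, e2]
    rw [h2] at h1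
    have h3 := EReal.coe_ennreal_le_coe_ennreal_iff.2 h1
    rw [EReal.coe_ennreal_add] at h3
    have h4 : ((∫ ω, r ω * g ω ∂ν - ∫ ω, (y₀ * r ω - c₀) ∂ν - ∫ ω, g ω ∂ν : ℝ) : EReal) ≤
      ((ENNReal.ofReal (∫ ω, r ω * g ω ∂ν - ∫ ω, (y₀ * r ω - c₀) ∂ν - ∫ ω, g ω ∂ν) : ℝ≥0∞) : EReal) := by
      rw [EReal.coe_ennreal_ofReal]
      exact_mod_cast le_max_left _ _
    rw [add_add_add_comm, ← EReal.coe_add]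
    refine le_trans (le_of_eq ?_) (add_le_add_left (h4.trans h3) _)
    rw [← EReal.coe_add]
    congr 1
    ring
  refine EReal.sub_le_of_le_add ?_
  unfold divE
  rw [hdec, EReal.coe_add, add_right_comm, add_comm]
  exact add_le_add key hsing

theorem runMax_integrable {Ω : Type*} [MeasurableSpace Ω] (ν : Measure Ω) [IsFiniteMeasure ν]
    (y c : ℕ → ℝ) (n : ℕ) (r : Ω → ℝ) (hrm : Measurable r) (hri : Integrable r ν) :
    Integrable (fun ω => r ω * (runMax y c n (r ω)).1) ν ∧
      Integrable (fun ω => (runMax y c n (r ω)).2) ν := by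
  obtain ⟨C, hC⟩ := runMax_bdd y c n
  have hm := (runMax_measurable y c n).comp hrm
  constructor
  · exact hri.mul_bdd (c := C) hm.fst.aestronglyMeasurable
      (Eventually.of_forall fun ω => (hC (r ω)).1)
  · exact Integrable.of_bound hm.snd.aestronglyMeasurable C
      (Eventually.of_forall fun ω => (hC (r ω)).2)

theorem lower_value {Ω : Type*} [MeasurableSpace Ω] (φ : ℝ → EReal) (dpos dneg : EReal)
    (μ ν : Measure Ω) [IsFiniteMeasure μ] [IsFiniteMeasure ν]
    (y c : ℕ → ℝ) (hyc : ∀ n, ∀ x : ℝ, ((y n * x - c n : ℝ) : EReal) ≤ φ x)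
    (hsl : ∀ n, dneg ≤ (y n : EReal) ∧ (y n : EReal) ≤ dpos)
    (n : ℕ) (d : ℝ) (hd1 : dneg ≤ (d : EReal)) (hd2 : (d : EReal) ≤ dpos) :
    ∃ g : Ω → ℝ, Measurable g ∧ (∃ C : ℝ, ∀ ω, |g ω| ≤ C) ∧
      (∀ ω, dneg ≤ (g ω : EReal) ∧ (g ω : EReal) ≤ dpos) ∧
      ((∫ ω, ((runMax y c n (μ.rnDeriv ν ω).toReal).1 * (μ.rnDeriv ν ω).toReal -
          (runMax y c n (μ.rnDeriv ν ω).toReal).2) ∂ν +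
          d * (μ.singularPart ν Set.univ).toReal : ℝ) : EReal) ≤
        ((∫ ω, g ω ∂μ : ℝ) : EReal) - eIntegral ν (fun ω => phiStarE φ (g ω)) := by
  classical
  have hrm : Measurable fun ω => (μ.rnDeriv ν ω).toReal :=
    (Measure.measurable_rnDeriv μ ν).ennreal_toReal
  have hri : Integrable (fun ω => (μ.rnDeriv ν ω).toReal) ν := Measure.integrable_toReal_rnDeriv
  have hms := Measure.mutuallySingular_singularPart μ ν
  set S := hms.nullSet
  have hS : MeasurableSet S := hms.measurableSet_nullSet
  have hS1 : ∀ᵐ ω ∂(μ.singularPart ν), ω ∉ S := by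
    have h := hms.measure_nullSet
    rw [ae_iff]; simp only [not_not]; exact h
  have hS2 : ∀ᵐ ω ∂ν, ω ∈ S := by
    have h := hms.measure_compl_nullSet
    rw [ae_iff]; exact h
  obtain ⟨hI1, hI2⟩ := runMax_integrable ν y c n _ hrm hri
  have hm := (runMax_measurable y c n).comp hrm
  obtain ⟨C, hC⟩ := runMax_bdd y c n
  let g : Ω → ℝ := fun ω => if ω ∈ S then (runMax y c n (μ.rnDeriv ν ω).toReal).1 else d
  have hgm : Measurable g := Measurable.ite hS hm.fst measurable_const
  have hgC : ∀ ω, |g ω| ≤ max C |d| := by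
    intro ω
    by_cases h : ω ∈ S
    · simp only [g, if_pos h]; exact (hC _).1.trans (le_max_left _ _)
    · simp only [g, if_neg h]; exact le_max_right _ _
  refine ⟨g, hgm, ⟨_, hgC⟩, ?_, ?_⟩
  · intro ω
    by_cases h : ω ∈ S
    · simp only [g, if_pos h]
      obtain ⟨k, -, hk⟩ := runMax_mem y c n (μ.rnDeriv ν ω).toReal
      rw [hk]; exact hsl k
    · simp only [g, if_neg h]; exact ⟨hd1, hd2⟩
  · obtain ⟨hi, hdec⟩ := integral_decomp μ ν g
      (Integrable.of_bound hgm.aestronglyMeasurable _ (Eventually.of_forall hgC))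
    have e1 : ∫ ω, g ω ∂(μ.singularPart ν) = d * (μ.singularPart ν Set.univ).toReal := by
      have : ∫ ω, g ω ∂(μ.singularPart ν) = ∫ _, d ∂(μ.singularPart ν) := by
        refine integral_congr_ae ?_
        filter_upwards [hS1] with ω h
        simp only [g, if_neg h]
      rw [this, integral_const, smul_eq_mul, measureReal_def, mul_comm]
    have e2 : ∫ ω, (μ.rnDeriv ν ω).toReal * g ω ∂ν =
        ∫ ω, (μ.rnDeriv ν ω).toReal * (runMax y c n (μ.rnDeriv ν ω).toReal).1 ∂ν := by
      refine integral_congr_ae ?_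
      filter_upwards [hS2] with ω h
      simp only [g, if_pos h]
    have e3 : eIntegral ν (fun ω => phiStarE φ (g ω)) ≤
        ((∫ ω, (runMax y c n (μ.rnDeriv ν ω).toReal).2 ∂ν : ℝ) : EReal) := by
      rw [← eIntegral_coe ν _ hI2]
      refine eIntegral_mono_ae _ _ _ ?_
      filter_upwards [hS2] with ω h
      simp only [g, if_pos h]
      obtain ⟨k, -, hk⟩ := runMax_mem y c n (μ.rnDeriv ν ω).toReal
      rw [hk]
      exact phiStar_le φ _ _ (hyc k)
    refine le_trans ?_ (EReal.sub_le_sub le_rfl e3)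
    rw [hdec, e1, e2, ← EReal.coe_sub, EReal.coe_le_coe_iff]
    have e4 := integral_sub hI1 hI2
    simp only [mul_comm (runMax y c n _).1]
    rw [e4]
    linarith

theorem final_step {Ω : Type*} [MeasurableSpace Ω] (φ : ℝ → EReal)
    (hlsc : LowerSemicontinuous φ) (dpos dneg : EReal)
    (μ ν : Measure Ω) [IsFiniteMeasure μ] [IsFiniteMeasure ν]
    (y c : ℕ → ℝ) (hyc : ∀ n, ∀ x : ℝ, ((y n * x - c n : ℝ) : EReal) ≤ φ x)
    (happ : ∀ x t : ℝ, (t : EReal) < φ x → ∃ n, t < y n * x - c n)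
    (hsl : ∀ n, dneg ≤ (y n : EReal) ∧ (y n : EReal) ≤ dpos) (V : EReal)
    (hV : ∀ (n : ℕ) (d : ℝ), dneg ≤ (d : EReal) → (d : EReal) ≤ dpos →
      ((∫ ω, ((runMax y c n (μ.rnDeriv ν ω).toReal).1 * (μ.rnDeriv ν ω).toReal -
          (runMax y c n (μ.rnDeriv ν ω).toReal).2) ∂ν +
          d * (μ.singularPart ν Set.univ).toReal : ℝ) : EReal) ≤ V) :
    divE φ dpos μ ν ≤ V := by
  have hrm : Measurable fun ω => (μ.rnDeriv ν ω).toReal :=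
    (Measure.measurable_rnDeriv μ ν).ennreal_toReal
  have hri : Integrable (fun ω => (μ.rnDeriv ν ω).toReal) ν := Measure.integrable_toReal_rnDeriv
  unfold divE
  have hfin : μ.singularPart ν Set.univ ≠ ⊤ := measure_ne_top _ _
  rw [← EReal.coe_ennreal_toReal hfin]
  set m : ℝ := (μ.singularPart ν Set.univ).toReal with hm
  have hm0 : 0 ≤ m := ENNReal.toReal_nonneg
  set r : Ω → ℝ := fun ω => (μ.rnDeriv ν ω).toReal with hr
  let q : ℕ → Ω → ℝ := fun n ω => (runMax y c n (r ω)).1 * r ω - (runMax y c n (r ω)).2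
  have hqm : ∀ n, Measurable (q n) := fun n => by
    have hm := (runMax_measurable y c n).comp hrm
    exact (hm.fst.mul hrm).sub hm.snd
  have hqi : ∀ n, Integrable (q n) ν := fun n => by
    obtain ⟨hI1, hI2⟩ := runMax_integrable ν y c n _ hrm hri
    have := hI1.sub hI2
    refine this.congr (Eventually.of_forall fun ω => ?_)
    simp only [q, Pi.sub_apply, mul_comm, hr]
  have hqle : ∀ n ω, (q n ω : EReal) ≤ φ (r ω) := fun n ω => by
    obtain ⟨k, -, hk⟩ := runMax_mem y c n (r ω)
    simp only [q, hk]; exact hyc k _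
  have hqmono : ∀ ω, Monotone fun n => q n ω := fun ω => runMax_mono y c (r ω)
  -- monotone convergence
  have hE := eIntegral_eq ν (fun ω => φ (r ω)) (hlsc.measurable.comp hrm) (q 0) (hqi 0) (hqm 0)
    (hqle 0)
  have hsup : ∀ ω, (φ (r ω) - (q 0 ω : EReal)).toENNReal =
      ⨆ n, ENNReal.ofReal (q n ω - q 0 ω) := by
    intro ω
    apply le_antisymm
    · refine le_of_forall_lt fun t ht => ?_
      have htop : t ≠ ⊤ := ht.ne_top
      lift t to ℝ≥0 using htop
      have h1 : ((t : ℝ) : EReal) < φ (r ω) - (q 0 ω : EReal) := by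
        by_contra hcon
        have := EReal.toENNReal_le_toENNReal (not_lt.1 hcon)
        rw [EReal.real_coe_toENNReal, ENNReal.ofReal_coe_nnreal] at this
        exact absurd ht (not_lt.2 this)
      have h2 : ((t + q 0 ω : ℝ) : EReal) < φ (r ω) := by
        rw [EReal.coe_add]
        exact (EReal.lt_sub_iff_add_lt (.inl (EReal.coe_ne_bot _))
          (.inl (EReal.coe_ne_top _))).1 h1
      obtain ⟨n, hn⟩ := happ _ _ h2
      have h3 := hn.trans_le (runMax_ge y c (r ω) n)
      refine lt_of_lt_of_le ?_ (le_iSup _ n)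
      rw [← ENNReal.ofReal_coe_nnreal, ENNReal.ofReal_lt_ofReal_iff_of_nonneg t.coe_nonneg]
      simp only [q] at h3 ⊢
      linarith
    · refine iSup_le fun n => ?_
      rw [← EReal.real_coe_toENNReal, EReal.coe_sub]
      exact EReal.toENNReal_le_toENNReal (EReal.sub_le_sub (hqle n ω) le_rfl)
  have hMC : ∫⁻ ω, (φ (r ω) - (q 0 ω : EReal)).toENNReal ∂ν =
      ⨆ n, ∫⁻ ω, ENNReal.ofReal (q n ω - q 0 ω) ∂ν := by
    simp only [hsup]
    refine lintegral_iSup (fun n => ((hqm n).sub (hqm 0)).ennreal_ofReal) ?_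
    intro a b hab ω
    exact ENNReal.ofReal_le_ofReal (sub_le_sub_right (hqmono ω hab) _)
  have hlin : ∀ n, ∫⁻ ω, ENNReal.ofReal (q n ω - q 0 ω) ∂ν =
      ENNReal.ofReal (∫ ω, q n ω ∂ν - ∫ ω, q 0 ω ∂ν) := by
    intro n
    rw [← integral_sub (hqi n) (hqi 0), ofReal_integral_eq_lintegral_ofReal]
    · exact (hqi n).sub (hqi 0)
    · exact Eventually.of_forall fun ω => sub_nonneg.2 (hqmono ω (Nat.zero_le n))
  have hEle : ∀ t : ℝ, (∀ n, ∫ ω, q n ω ∂ν ≤ t) →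
      eIntegral ν (fun ω => φ (r ω)) ≤ (t : EReal) := by
    intro t ht
    have h1 : ∫⁻ ω, (φ (r ω) - (q 0 ω : EReal)).toENNReal ∂ν ≤
        ENNReal.ofReal (t - ∫ ω, q 0 ω ∂ν) := by
      rw [hMC]
      refine iSup_le fun n => ?_
      rw [hlin]
      exact ENNReal.ofReal_le_ofReal (sub_le_sub_right (ht n) _)
    rw [hE]
    have h2 := EReal.coe_ennreal_le_coe_ennreal_iff.2 h1
    rw [EReal.coe_ennreal_ofReal, max_eq_left (sub_nonneg.2 (ht 0))] at h2
    refine (add_le_add_left h2 _).trans (le_of_eq ?_)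
    rw [← EReal.coe_add]; congr 1; ring
  have hEbot : ((∫ ω, q 0 ω ∂ν : ℝ) : EReal) ≤ eIntegral ν (fun ω => φ (r ω)) := by
    rw [hE]
    exact le_add_of_nonneg_left (EReal.coe_ennreal_nonneg _)
  have hV' : ∀ (n : ℕ) (d : ℝ), dneg ≤ (d : EReal) → (d : EReal) ≤ dpos →
      ((∫ ω, q n ω ∂ν + d * m : ℝ) : EReal) ≤ V := hV
  clear hV
  induction V with
  | top => exact le_top
  | bot => have := hV' 0 (y 0) (hsl 0).1 (hsl 0).2; exact absurd (le_bot_iff.1 this) (EReal.coe_ne_bot _)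
  | coe v =>
    simp only [EReal.coe_le_coe_iff] at hV'
    have hd : ∀ d : ℝ, dneg ≤ (d : EReal) → (d : EReal) ≤ dpos →
        eIntegral ν (fun ω => φ (r ω)) ≤ ((v - d * m : ℝ) : EReal) := by
      intro d h1 h2
      exact hEle _ fun n => by linarith [hV' n d h1 h2]
    generalize eIntegral ν (fun ω => φ (r ω)) = E at hd hEbot
    induction dpos with
    | bot => have := (hsl 0).2; simp at this
    | coe p =>
      have h1 := hd p ((hsl 0).1.trans (hsl 0).2) le_rfl
      rw [← EReal.coe_mul]
      refine (add_le_add_left h1 _).trans (le_of_eq ?_)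
      rw [← EReal.coe_add]; congr 1; ring
    | top =>
      rcases hm0.lt_or_eq with hpos | h0
      · exfalso
        set d := max (y 0) ((v - ∫ ω, q 0 ω ∂ν + 1) / m) with hdd
        have h1 := hV' 0 d ((hsl 0).1.trans (by exact_mod_cast le_max_left _ _)) le_top
        have h2 : (v - ∫ ω, q 0 ω ∂ν + 1) / m ≤ d := le_max_right _ _
        rw [div_le_iff₀ hpos] at h2
        linarith
      · rw [← h0]
        have h1 := hd (y 0) (hsl 0).1 le_top
        rw [← h0] at h1
        simpa using h1

/-- **Variational representation of the φ-divergence for finite nonnegative measures.**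
Let `φ : ℝ → ℝ ∪ {+∞}` be proper convex lower semicontinuous with `φ(1) = 0`, and let
`φ'(∞) = lim_{x→∞} φ(x)/x` and `φ'(−∞) = lim_{x→−∞} φ(x)/x`.  For a nonzero finite
nonnegative measure `ν` and a finite nonnegative measure `μ`,
`D_φ(μ‖ν) = sup { ∫ g dμ − ∫ φ*(g) dν }`, the supremum being over bounded measurable
`g : Ω → ℝ` with `φ'(−∞) ≤ g(ω) ≤ φ'(∞)` for every `ω`. -/
theorem divergence_eq_biconjugate_general {Ω : Type*} [MeasurableSpace Ω]
    (φ : ℝ → EReal)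
    (hbot : ∀ x : ℝ, φ x ≠ ⊥)
    (hconv : ∀ x y a b : ℝ, 0 ≤ a → 0 ≤ b → a + b = 1 →
      φ (a * x + b * y) ≤ (a : EReal) * φ x + (b : EReal) * φ y)
    (hlsc : LowerSemicontinuous φ)
    (hone : φ 1 = 0)
    (dpos dneg : EReal)
    (hdpos : Tendsto (fun x : ℝ => φ x * ((x⁻¹ : ℝ) : EReal)) atTop (𝓝 dpos))
    (hdneg : Tendsto (fun x : ℝ => φ x * ((x⁻¹ : ℝ) : EReal)) atBot (𝓝 dneg))
    (μ ν : Measure Ω) [IsFiniteMeasure μ] [IsFiniteMeasure ν] (hν : ν ≠ 0) :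
    divE φ dpos μ ν =
      ⨆ (g : Ω → ℝ) (_ : Measurable g ∧ (∃ C : ℝ, ∀ ω, |g ω| ≤ C) ∧
          ∀ ω, dneg ≤ (g ω : EReal) ∧ (g ω : EReal) ≤ dpos),
        ((∫ ω, g ω ∂μ : ℝ) : EReal) - eIntegral ν (fun ω => phiStarE φ (g ω)) := by
  
  obtain ⟨y, c, hyc, happ⟩ := exists_seq φ hbot hconv hlsc hone
  have hsl : ∀ n, dneg ≤ (y n : EReal) ∧ (y n : EReal) ≤ dpos := fun n =>
    slope_bounds φ dpos dneg hdpos hdneg (y n) (c n) (hyc n)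
  apply le_antisymm
  · refine final_step φ hlsc dpos dneg μ ν y c hyc happ hsl _ ?_
    intro n d hd1 hd2
    obtain ⟨g, hg, hC, hgd, hle⟩ := lower_value φ dpos dneg μ ν y c hyc hsl n d hd1 hd2
    exact hle.trans (le_iSup₂_of_le g ⟨hg, hC, hgd⟩ le_rfl)
  · refine iSup₂_le fun g hg => ?_
    obtain ⟨hgm, ⟨C, hC⟩, hgd⟩ := hg
    exact upper_bound φ hbot hlsc hone dpos μ ν (y 0) (c 0) (hyc 0) (hsl 0).2 g hgm C hC
      (fun ω => (hgd ω).2)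
end

section
/- For every probability measure ν on (Ω,F) and every measurable g : Ω → ℝ, the function Λ_{g,ν} : ℝ → [0,∞] is nonnegative, convex, lower semicontinuous, and satisfies Λ_{g,ν}(0) = 0. Moreover: if g is not ν-almost-everywhere equal to a constant, then every sublevel set {t ∈ ℝ : Λ_{g,ν}(t) ≤ c} (c ∈ ℝ) is compact; and if g is ν-almost-everywhere equal to a constant, then Λ_{g,ν}(t) = 0 for all t ∈ ℝ. -/
open MeasureTheory Filter Set
open scoped ENNReal NNReal Topology

/-- `ψ*(y) = sup_{x ∈ ℝ} (x·y − φ(x+1))`, the convex conjugate of `ψ(x) := φ(x+1)`.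
Since `φ 1 = 0`, the supremum is nonnegative (take `x = 0`), so we record it in `ℝ≥0∞`. -/
noncomputable def psiStar (φ : ℝ → ℝ≥0∞) (y : ℝ) : ℝ≥0∞ :=
  erealToENNReal (⨆ x : ℝ, ((x * y : ℝ) : EReal) - ((φ (x + 1) : ℝ≥0∞) : EReal))

/-- The `(φ,ν)`-cumulant generating function `Λ_{g,ν}(t) = inf_{λ ∈ ℝ} ∫ ψ*(t·g + λ) dν`. -/
noncomputable def cgf {Ω : Type*} [MeasurableSpace Ω] (φ : ℝ → ℝ≥0∞)
    (ν : Measure Ω) (g : Ω → ℝ) (t : ℝ) : ℝ≥0∞ :=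
  ⨅ lam : ℝ, ∫⁻ ω, psiStar φ (t * g ω + lam) ∂ν

lemma cgfAux_toENNReal_sub (z : ℝ) (c : ℝ≥0∞) :
    erealToENNReal ((z : EReal) - (c : EReal)) = ENNReal.ofReal z - c := by
  rcases eq_or_ne c ⊤ with rfl | hc
  · simp [erealToENNReal]
  · lift c to ℝ≥0 using hc
    have : ((z : EReal) - (((c : ℝ≥0∞)) : EReal)) = ((z - (c : ℝ) : ℝ) : EReal) := by
      rw [EReal.coe_sub]; rfl
    rw [this, erealToENNReal, if_neg (EReal.coe_ne_top _), EReal.toReal_coe,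
      ENNReal.ofReal_sub _ (NNReal.coe_nonneg c)]
    simp

lemma cgfAux_psiStar_eq (φ : ℝ → ℝ≥0∞) (y : ℝ) :
    psiStar φ y = ⨆ x : ℝ, (ENNReal.ofReal (x * y) - φ (x + 1)) := by
  simp_rw [← cgfAux_toENNReal_sub]
  exact Monotone.map_iSup_of_continuousAt (f := EReal.toENNReal)
    EReal.continuous_toENNReal.continuousAt
    (fun _ _ h => EReal.toENNReal_le_toENNReal h) (by simp)

lemma cgfAux_psiStar_zero (φ : ℝ → ℝ≥0∞) : psiStar φ 0 = 0 := by
  simp [cgfAux_psiStar_eq]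

lemma cgfAux_le_psiStar (φ : ℝ → ℝ≥0∞) (x y : ℝ) :
    ENNReal.ofReal (x * y) ≤ psiStar φ y + φ (x + 1) := by
  rw [cgfAux_psiStar_eq, ← tsub_le_iff_right]
  exact le_iSup (fun x : ℝ => (ENNReal.ofReal (x * y) - φ (x + 1))) x

lemma cgfAux_psiStar_lsc (φ : ℝ → ℝ≥0∞) : LowerSemicontinuous (psiStar φ) := by
  have : psiStar φ = fun y => ⨆ x : ℝ, (ENNReal.ofReal (x * y) - φ (x + 1)) :=
    funext (cgfAux_psiStar_eq φ)
  rw [this]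
  refine lowerSemicontinuous_iSup fun x => Continuous.lowerSemicontinuous ?_
  exact (ENNReal.continuous_sub_right _).comp
    (ENNReal.continuous_ofReal.comp (continuous_const.mul continuous_id))

lemma cgfAux_psiStar_convex (φ : ℝ → ℝ≥0∞) (y₁ y₂ : ℝ) (a b : ℝ≥0) (hab : a + b = 1) :
    psiStar φ (a * y₁ + b * y₂) ≤ a * psiStar φ y₁ + b * psiStar φ y₂ := by
  rw [cgfAux_psiStar_eq φ (a * y₁ + b * y₂)]
  refine iSup_le fun x => ?_
  rw [tsub_le_iff_right]
  have hab' : (a : ℝ≥0∞) + b = 1 := by exact_mod_cast hab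
  calc ENNReal.ofReal (x * (a * y₁ + b * y₂))
      = ENNReal.ofReal (a * (x * y₁) + b * (x * y₂)) := by congr 1; ring
    _ ≤ ENNReal.ofReal (a * (x * y₁)) + ENNReal.ofReal (b * (x * y₂)) :=
        ENNReal.ofReal_add_le
    _ = a * ENNReal.ofReal (x * y₁) + b * ENNReal.ofReal (x * y₂) := by
        rw [ENNReal.ofReal_mul (NNReal.coe_nonneg a), ENNReal.ofReal_mul (NNReal.coe_nonneg b)]; simp
    _ ≤ a * (psiStar φ y₁ + φ (x + 1)) + b * (psiStar φ y₂ + φ (x + 1)) := by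
        gcongr <;> exact cgfAux_le_psiStar _ _ _
    _ = a * psiStar φ y₁ + b * psiStar φ y₂ + (a + b) * φ (x + 1) := by ring
    _ = _ := by rw [hab', one_mul]

lemma cgfAux_growth (φ : ℝ → ℝ≥0∞) (hdom : (1 : ℝ) ∈ interior {x : ℝ | φ x ≠ ⊤}) :
    ∃ e : ℝ, 0 < e ∧ ∃ M : ℝ≥0∞, M ≠ ⊤ ∧
      ∀ y, ENNReal.ofReal (e * |y|) ≤ psiStar φ y + M := by
  rw [mem_interior_iff_mem_nhds, Metric.mem_nhds_iff] at hdom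
  obtain ⟨r, hr, hsub⟩ := hdom
  have h1 : φ (r / 2 + 1) ≠ ⊤ := hsub (by
    rw [Metric.mem_ball, Real.dist_eq, add_sub_cancel_right, abs_of_pos (by linarith)]; linarith)
  have h2 : φ (-(r / 2) + 1) ≠ ⊤ := hsub (by
    rw [Metric.mem_ball, Real.dist_eq, add_sub_cancel_right, abs_neg, abs_of_pos (by linarith)]
    linarith)
  refine ⟨r / 2, by linarith, φ (r / 2 + 1) + φ (-(r / 2) + 1),
    ENNReal.add_ne_top.2 ⟨h1, h2⟩, fun y => ?_⟩
  rcases abs_cases y with ⟨h, _⟩ | ⟨h, _⟩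
  · rw [h]
    refine (cgfAux_le_psiStar φ (r / 2) y).trans ?_
    gcongr
    exact le_self_add
  · rw [h]
    have := cgfAux_le_psiStar φ (-(r / 2)) y
    rw [neg_mul, ← mul_neg] at this
    refine this.trans ?_
    gcongr
    exact le_add_self

lemma cgfAux_coercive {Ω : Type*} [MeasurableSpace Ω] (φ : ℝ → ℝ≥0∞)
    (hdom : (1 : ℝ) ∈ interior {x : ℝ | φ x ≠ ⊤}) (ν : Measure Ω) (δ c : ℝ≥0∞)
    (hδ : δ ≠ 0) (hc : c ≠ ⊤) :
    ∃ R : ℝ, 0 ≤ R ∧ ∀ (A : Set Ω) (h : Ω → ℝ), MeasurableSet A → δ ≤ ν A →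
      (∀ ω ∈ A, R ≤ |h ω|) → c < ∫⁻ ω, psiStar φ (h ω) ∂ν := by
  obtain ⟨e, he, M, hM, hgr⟩ := cgfAux_growth φ hdom
  -- replace `δ` by a finite positive number
  set d : ℝ≥0∞ := min δ 1 with hd
  have hd0 : d ≠ 0 := by
    simp [hd, hδ]
  have hd1 : d ≠ ⊤ := ne_top_of_le_ne_top ENNReal.one_ne_top (min_le_right _ _)
  have hK : c / d + M ≠ ⊤ := ENNReal.add_ne_top.2 ⟨ENNReal.div_ne_top hc hd0, hM⟩
  refine ⟨((c / d + M).toReal + 1) / e, by positivity, fun A h hA hδA hR => ?_⟩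
  have key : ∀ ω ∈ A, c / d + 1 ≤ psiStar φ (h ω) := by
    intro ω hω
    have h1 : (c / d + M).toReal + 1 ≤ e * |h ω| := by
      have := hR ω hω
      rw [div_le_iff₀ he] at this
      linarith
    have h2 := (ENNReal.ofReal_le_ofReal h1).trans (hgr (h ω))
    rw [ENNReal.ofReal_add ENNReal.toReal_nonneg zero_le_one, ENNReal.ofReal_toReal hK,
      ENNReal.ofReal_one, add_right_comm] at h2
    exact (ENNReal.add_le_add_iff_right hM).1 h2
  calc c < c + d := ENNReal.lt_add_right hc hd0
    _ = (c / d + 1) * d := by rw [add_mul, ENNReal.div_mul_cancel hd0 hd1, one_mul]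
    _ ≤ (c / d + 1) * ν A := by gcongr; exact (min_le_left _ _).trans hδA
    _ = ∫⁻ _ in A, (c / d + 1) ∂ν := (setLIntegral_const _ _).symm
    _ ≤ ∫⁻ ω in A, psiStar φ (h ω) ∂ν := setLIntegral_mono' hA key
    _ ≤ _ := setLIntegral_le_lintegral _ _

lemma cgfAux_measurable {Ω : Type*} [MeasurableSpace Ω] (φ : ℝ → ℝ≥0∞)
    (g : Ω → ℝ) (hg : Measurable g) (t l : ℝ) :
    Measurable fun ω => psiStar φ (t * g ω + l) :=
  (cgfAux_psiStar_lsc φ).measurable.comp ((hg.const_mul t).add_const l)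

lemma cgfAux_J_lsc {Ω : Type*} [MeasurableSpace Ω] (φ : ℝ → ℝ≥0∞) (ν : Measure Ω)
    (g : Ω → ℝ) (hg : Measurable g) :
    LowerSemicontinuous fun p : ℝ × ℝ => ∫⁻ ω, psiStar φ (p.1 * g ω + p.2) ∂ν := by
  rw [lowerSemicontinuous_iff_isClosed_preimage]
  intro c
  refine IsSeqClosed.isClosed fun s p hs hp => ?_
  simp only [mem_preimage, mem_Iic] at hs ⊢
  calc ∫⁻ ω, psiStar φ (p.1 * g ω + p.2) ∂ν
      ≤ ∫⁻ ω, liminf (fun n => psiStar φ ((s n).1 * g ω + (s n).2)) atTop ∂ν := by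
        refine lintegral_mono fun ω => ?_
        have hc : Continuous fun q : ℝ × ℝ => q.1 * g ω + q.2 := by fun_prop
        have ht : Tendsto (fun n => (s n).1 * g ω + (s n).2) atTop (𝓝 (p.1 * g ω + p.2)) :=
          (hc.tendsto p).comp hp
        refine le_of_forall_lt fun y hy => ?_
        obtain ⟨z, hyz, hz⟩ := exists_between hy
        refine hyz.trans_le (le_liminf_of_le (by isBoundedDefault) ?_)
        filter_upwards [ht.eventually (cgfAux_psiStar_lsc φ _ z hz)] with n hn using hn.le
    _ ≤ liminf (fun n => ∫⁻ ω, psiStar φ ((s n).1 * g ω + (s n).2) ∂ν) atTop :=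
        lintegral_liminf_le fun n => cgfAux_measurable φ g hg _ _
    _ ≤ liminf (fun _ : ℕ => c) atTop := liminf_le_liminf (Eventually.of_forall hs)
    _ = c := liminf_const c

lemma cgfAux_gap {Ω : Type*} [MeasurableSpace Ω] (ν : Measure Ω) (g : Ω → ℝ)
    (hne : ¬ ∃ c : ℝ, g =ᵐ[ν] fun _ => c) :
    ∃ a b : ℝ, a < b ∧ ν {ω | g ω ≤ a} ≠ 0 ∧ ν {ω | b ≤ g ω} ≠ 0 := by
  by_contra hcon
  push Not at hcon
  apply hne
  have : HasCountableSeparatingOn ℝ (fun s => ∃ q : ℚ, s = Iic (q : ℝ)) univ := by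
    refine ⟨range fun q : ℚ => Iic (q : ℝ), countable_range _, ?_, ?_⟩
    · rintro _ ⟨q, rfl⟩; exact ⟨q, rfl⟩
    · intro x _ y _ h
      by_contra hxy
      rcases lt_or_gt_of_ne hxy with h' | h'
      · obtain ⟨q, h1, h2⟩ := exists_rat_btwn h'
        exact absurd ((h _ ⟨q, rfl⟩).1 h1.le) (not_le.2 h2)
      · obtain ⟨q, h1, h2⟩ := exists_rat_btwn h'
        exact absurd ((h _ ⟨q, rfl⟩).2 h1.le) (not_le.2 h2)
  refine Filter.exists_eventuallyEq_const_of_forall_separating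
    (fun s => ∃ q : ℚ, s = Iic (q : ℝ)) ?_
  rintro _ ⟨q, rfl⟩
  by_cases hq : ν {ω | g ω ≤ q} = 0
  · right
    rw [ae_iff]
    simpa using hq
  · left
    have : ∀ n : ℕ, ∀ᵐ ω ∂ν, g ω < q + 1 / ((n : ℝ) + 1) := by
      intro n
      rw [ae_iff]
      simpa only [not_lt] using hcon q (q + 1 / ((n : ℝ) + 1))
        (by have : 0 < 1 / ((n : ℝ) + 1) := by positivity
            linarith) hq
    filter_upwards [ae_all_iff.2 this] with ω hω
    change g ω ≤ (q : ℝ)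
    refine le_of_forall_pos_le_add fun ε hε => ?_
    obtain ⟨n, hn⟩ := exists_nat_one_div_lt hε
    linarith [hω n]

lemma cgfAux_large {Ω : Type*} [MeasurableSpace Ω] (ν : Measure Ω) [IsProbabilityMeasure ν]
    (g : Ω → ℝ) : ∃ n : ℕ, ν {ω | |g ω| ≤ n} ≠ 0 := by
  by_contra hcon
  push Not at hcon
  have h : ν (⋃ n : ℕ, {ω | |g ω| ≤ n}) = 0 := measure_iUnion_null hcon
  have h2 : (⋃ n : ℕ, {ω | |g ω| ≤ n}) = univ := by
    ext ω
    simpa using exists_nat_ge |g ω|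
  rw [h2, measure_univ] at h
  exact one_ne_zero h

lemma cgfAux_lsc {Ω : Type*} [MeasurableSpace Ω] (φ : ℝ → ℝ≥0∞)
    (hdom : (1 : ℝ) ∈ interior {x : ℝ | φ x ≠ ⊤})
    (ν : Measure Ω) [IsProbabilityMeasure ν] (g : Ω → ℝ) (hg : Measurable g) :
    LowerSemicontinuous (cgf φ ν g) := by
  intro t₀ y hy
  obtain ⟨r, hyr, hr⟩ := exists_between hy
  obtain ⟨K, hK⟩ := cgfAux_large ν g
  obtain ⟨R, hR0, hR⟩ := cgfAux_coercive φ hdom ν _ r hK hr.ne_top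
  set L : ℝ := R + (|t₀| + 1) * K with hL
  obtain ⟨u, v, hu, -, htu, hv, huv⟩ := generalized_tube_lemma
    (isCompact_singleton (x := t₀)) (isCompact_Icc (a := -L) (b := L))
    ((cgfAux_J_lsc φ ν g hg).isOpen_preimage r) (by
      rintro ⟨t, l⟩ ⟨ht, -⟩
      rw [mem_singleton_iff] at ht
      subst ht
      exact hr.trans_le (iInf_le _ l))
  filter_upwards [hu.mem_nhds (htu rfl), Metric.ball_mem_nhds t₀ one_pos] with t ht htb
  refine hyr.trans_le (le_iInf fun l => ?_)
  by_cases hl : l ∈ Icc (-L) L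
  · exact (huv (mk_mem_prod ht (hv hl)) : r < _).le
  · refine (hR _ _ (measurableSet_le (by fun_prop) measurable_const) le_rfl ?_).le
    intro ω (hω : |g ω| ≤ K)
    have hl' : L < |l| := by
      rw [← not_le, abs_le]; exact hl
    have ht' : |t| ≤ |t₀| + 1 := by
      rw [Metric.mem_ball, Real.dist_eq] at htb
      have := abs_sub_abs_le_abs_sub t t₀
      linarith
    have h1 : |t * g ω| ≤ (|t₀| + 1) * K := by
      rw [abs_mul]; gcongr
    have h2 : |l| ≤ |t * g ω + l| + |t * g ω| := by
      have := abs_sub (t * g ω + l) (t * g ω)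
      rwa [add_sub_cancel_left] at this
    linarith

lemma cgfAux_bounded {Ω : Type*} [MeasurableSpace Ω] (φ : ℝ → ℝ≥0∞)
    (hdom : (1 : ℝ) ∈ interior {x : ℝ | φ x ≠ ⊤})
    (ν : Measure Ω) (g : Ω → ℝ) (hg : Measurable g)
    (hne : ¬ ∃ c : ℝ, g =ᵐ[ν] fun _ => c) (c : ℝ≥0∞) (hc : c ≠ ⊤) :
    ∃ T : ℝ, ∀ t, cgf φ ν g t ≤ c → |t| ≤ T := by
  obtain ⟨a, b, hab, ha, hb⟩ := cgfAux_gap ν g hne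
  have hmin : min (ν {ω | g ω ≤ a}) (ν {ω | b ≤ g ω}) ≠ 0 := by
    rcases min_choice (ν {ω | g ω ≤ a}) (ν {ω | b ≤ g ω}) with h | h <;> rw [h] <;> assumption
  obtain ⟨R, hR0, hR⟩ := cgfAux_coercive φ hdom ν _ (c + 1) hmin (by simp [hc])
  have hba : 0 < (b - a) / 2 := by linarith
  refine ⟨R / ((b - a) / 2), fun t ht => ?_⟩
  by_contra! hT
  rw [div_lt_iff₀ hba] at hT
  have hT' : R < |t * ((b - a) / 2)| := by rwa [abs_mul, abs_of_pos hba]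
  have hlt : cgf φ ν g t < c + 1 := ht.trans_lt (ENNReal.lt_add_right hc one_ne_zero)
  obtain ⟨l, hl⟩ := iInf_lt_iff.1 hlt
  refine hl.not_gt ?_
  -- the value of the affine function at the midpoint decides which half-line to use
  by_cases hs : 0 ≤ t * (t * ((a + b) / 2) + l)
  · refine hR {ω | b ≤ g ω} _ (measurableSet_le measurable_const hg) (min_le_right _ _) ?_
    intro ω (hω : b ≤ g ω)
    refine hT'.le.trans (sq_le_sq.1 ?_)
    have h1 : t * g ω + l = t * ((b - a) / 2) + (t * (g ω - b) + (t * ((a + b) / 2) + l)) := by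
      ring
    rw [h1]
    have h2 : 0 ≤ t ^ 2 * (g ω - b) := mul_nonneg (sq_nonneg t) (by linarith)
    have h3 : 0 ≤ ((b - a) / 2) * (t * (t * (g ω - b) + (t * ((a + b) / 2) + l))) :=
      mul_nonneg hba.le (by linarith)
    nlinarith [sq_nonneg (t * (g ω - b) + (t * ((a + b) / 2) + l))]
  · refine hR {ω | g ω ≤ a} _ (measurableSet_le hg measurable_const) (min_le_left _ _) ?_
    intro ω (hω : g ω ≤ a)
    refine hT'.le.trans (sq_le_sq.1 ?_)
    have h1 : t * g ω + l = -(t * ((b - a) / 2)) + (t * (g ω - a) + (t * ((a + b) / 2) + l)) := by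
      ring
    rw [h1]
    have h2 : 0 ≤ t ^ 2 * (a - g ω) := mul_nonneg (sq_nonneg t) (by linarith)
    have h3 : 0 ≤ ((b - a) / 2) * -(t * (t * (g ω - a) + (t * ((a + b) / 2) + l))) :=
      mul_nonneg hba.le (by linarith)
    nlinarith [sq_nonneg (t * (g ω - a) + (t * ((a + b) / 2) + l))]

/-- **Basic properties of the `(φ,ν)`-cumulant generating function.**  For every
probability measure `ν` and measurable `g : Ω → ℝ`, the function `Λ_{g,ν}` is
nonnegative, convex, lower semicontinuous, and `Λ_{g,ν}(0) = 0`.  Moreover, if `g` is not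
`ν`-a.e. constant then every sublevel set of `Λ_{g,ν}` at a finite level is compact, and
if `g` is `ν`-a.e. constant then `Λ_{g,ν} ≡ 0`. -/
theorem cgf_properties {Ω : Type*} [MeasurableSpace Ω] (φ : ℝ → ℝ≥0∞)
    (hconv : ∀ x y : ℝ, ∀ a b : ℝ≥0, a + b = 1 →
      φ ((a : ℝ) * x + (b : ℝ) * y) ≤ (a : ℝ≥0∞) * φ x + (b : ℝ≥0∞) * φ y)
    (hlsc : LowerSemicontinuous φ)
    (hneg : ∀ x : ℝ, x < 0 → φ x = ⊤)
    (hone : φ 1 = 0)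
    (hdom : (1 : ℝ) ∈ interior {x : ℝ | φ x ≠ ⊤})
    (ν : Measure Ω) [IsProbabilityMeasure ν] (g : Ω → ℝ) (hg : Measurable g) :
    (∀ t : ℝ, 0 ≤ cgf φ ν g t)
    ∧ (∀ t₁ t₂ : ℝ, ∀ a b : ℝ≥0, a + b = 1 →
        cgf φ ν g ((a : ℝ) * t₁ + (b : ℝ) * t₂)
          ≤ (a : ℝ≥0∞) * cgf φ ν g t₁ + (b : ℝ≥0∞) * cgf φ ν g t₂)
    ∧ LowerSemicontinuous (cgf φ ν g)
    ∧ cgf φ ν g 0 = 0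
    ∧ ((¬ ∃ c : ℝ, g =ᵐ[ν] fun _ => c) →
        ∀ c : ℝ≥0∞, c ≠ ⊤ → IsCompact {t : ℝ | cgf φ ν g t ≤ c})
    ∧ ((∃ c : ℝ, g =ᵐ[ν] fun _ => c) → ∀ t : ℝ, cgf φ ν g t = 0) := by
  refine ⟨fun t => zero_le, ?_, cgfAux_lsc φ hdom ν g hg, ?_, ?_, ?_⟩
  · intro t₁ t₂ a b hab
    rw [cgf, cgf, cgf, ENNReal.mul_iInf (by simp), ENNReal.mul_iInf (by simp), ENNReal.iInf_add]
    refine le_iInf fun l₁ => ?_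
    rw [ENNReal.add_iInf]
    refine le_iInf fun l₂ => ?_
    refine (iInf_le _ ((a : ℝ) * l₁ + b * l₂)).trans ?_
    rw [← lintegral_const_mul _ (cgfAux_measurable φ g hg _ _),
      ← lintegral_const_mul _ (cgfAux_measurable φ g hg _ _),
      ← lintegral_add_left ((cgfAux_measurable φ g hg _ _).const_mul _)]
    refine lintegral_mono fun ω => ?_
    have := cgfAux_psiStar_convex φ (t₁ * g ω + l₁) (t₂ * g ω + l₂) a b hab
    refine le_trans (le_of_eq ?_) this
    congr 1
    ring
  · refine le_antisymm ((iInf_le _ 0).trans ?_) zero_le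
    simp [cgfAux_psiStar_zero]
  · intro hne c hc
    obtain ⟨T, hT⟩ := cgfAux_bounded φ hdom ν g hg hne c hc
    refine Metric.isCompact_of_isClosed_isBounded
      ((cgfAux_lsc φ hdom ν g hg).isClosed_preimage c) ?_
    refine (Metric.isBounded_Icc (-T) T).subset fun t ht => ?_
    exact abs_le.1 (hT t ht)
  · rintro ⟨c, hc⟩ t
    refine le_antisymm ((iInf_le _ (-(t * c))).trans ?_) zero_le
    refine le_of_eq ?_
    rw [lintegral_eq_zero_iff (cgfAux_measurable φ g hg _ _)]
    filter_upwards [hc] with ω hω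
    simp [hω, cgfAux_psiStar_zero]
end

section
/- Let ν be a probability measure on (Ω,F) and g ∈ L¹(ν). Define L_g(ε) := inf{ D_φ(μ‖ν) : μ a probability measure with μ ≪ ν, g ∈ L¹(μ), and ∫ g dμ − ∫ g dν = ε } ∈ [0,∞], with inf ∅ = +∞. Then for every ε in the interior of {ε ∈ ℝ : L_g(ε) < ∞}, one has L_g(ε) = sup_{t∈ℝ} ( t·ε − Λ_{g,ν}(t) ). Moreover, if L_g is lower semicontinuous on ℝ, then this equality holds for every ε ∈ ℝ. -/
open MeasureTheory Filter Set
open scoped ENNReal NNReal Topology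

/-- The φ-divergence `D_φ(μ‖ν) = ∫ φ(dμ/dν) dν` for `μ ≪ ν`. -/
noncomputable def divAC {Ω : Type*} [MeasurableSpace Ω] (φ : ℝ → ℝ≥0∞)
    (μ ν : Measure Ω) : ℝ≥0∞ :=
  ∫⁻ ω, φ ((μ.rnDeriv ν ω).toReal) ∂ν


/-- One-dimensional separation by an explicit supremum of slopes. -/
lemma exists_slope {ι : Type*} (S : Set ι) (m v : ι → ℝ)
    (h0 : ∀ i ∈ S, m i = 0 → 0 ≤ v i)
    (hc : ∀ i ∈ S, ∀ j ∈ S, 0 < m i → m j < 0 → 0 ≤ (-m j) * v i + m i * v j)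
    (hA : ∃ A : ℝ, ∀ i ∈ S, 0 < m i → A * m i ≤ v i)
    (hB : ∃ B : ℝ, ∀ i ∈ S, m i < 0 → B * m i ≤ v i) :
    ∃ l : ℝ, ∀ i ∈ S, l * m i ≤ v i := by
  obtain ⟨A, hA⟩ := hA
  obtain ⟨B, hB⟩ := hB
  let T : Set ℝ := insert A {s | ∃ j ∈ S, m j < 0 ∧ s = v j / m j}
  have hbdd : BddAbove T := by
    refine ⟨max A B, ?_⟩
    rintro s (rfl | ⟨j, hj, hm, rfl⟩)
    · exact le_max_left _ _
    · refine le_trans ?_ (le_max_right _ _)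
      rw [div_le_iff_of_neg hm]
      exact hB j hj hm
  refine ⟨sSup T, fun i hi => ?_⟩
  rcases lt_trichotomy (m i) 0 with hm | hm | hm
  · have : v i / m i ≤ sSup T := le_csSup hbdd (Or.inr ⟨i, hi, hm, rfl⟩)
    rwa [div_le_iff_of_neg hm] at this
  · rw [hm, mul_zero]; exact h0 i hi hm
  · rw [← le_div_iff₀ hm]
    refine csSup_le ⟨A, Or.inl rfl⟩ ?_
    rintro s (rfl | ⟨j, hj, hmj, rfl⟩)
    · rw [le_div_iff₀ hm]; exact hA i hi hm
    · rw [le_div_iff₀ hm, div_mul_eq_mul_div, div_le_iff_of_neg hmj]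
      have := hc i hi j hj hm hmj
      nlinarith

lemma erealToENNReal_le {s : EReal} {c : ℝ≥0∞} (h : s ≤ (c : EReal)) :
    erealToENNReal s ≤ c := by
  unfold erealToENNReal
  split_ifs with hs
  · subst hs
    simpa using h
  · by_cases hc : c = ⊤
    · simp [hc]
    by_cases hb : s = ⊥
    · simp [hb]
    lift c to ℝ≥0 using hc
    lift s to ℝ using ⟨hs, hb⟩
    have h' : s ≤ (c : ℝ) := EReal.coe_le_coe_iff.1 h
    simpa [ENNReal.ofReal_le_iff_le_toReal] using h'

lemma le_erealToENNReal {s : EReal} {c : ℝ} (h : (c : EReal) ≤ s) :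
    ENNReal.ofReal c ≤ erealToENNReal s := by
  unfold erealToENNReal
  split_ifs with hs
  · simp
  · by_cases hb : s = ⊥
    · simp [hb] at h
    lift s to ℝ using ⟨hs, hb⟩
    exact ENNReal.ofReal_le_ofReal (by exact_mod_cast h)

lemma coe_sub_of_ne_top (a : ℝ) {c : ℝ≥0∞} (hc : c ≠ ⊤) :
    (a : EReal) - (c : EReal) = ((a - c.toReal : ℝ) : EReal) := by
  lift c to ℝ≥0 using hc
  rw [EReal.coe_sub]; rfl

/-- Fenchel-Young. -/
lemma fenchel_young (φ : ℝ → ℝ≥0∞) (p y : ℝ) :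
    ENNReal.ofReal ((p - 1) * y) ≤ φ p + psiStar φ y := by
  by_cases hp : φ p = ⊤
  · simp [hp]
  have h1 : ENNReal.ofReal ((p - 1) * y - (φ p).toReal) ≤ psiStar φ y := by
    apply le_erealToENNReal
    rw [← coe_sub_of_ne_top _ hp]
    have := le_iSup (fun x : ℝ => ((x * y : ℝ) : EReal) - ((φ (x + 1) : ℝ≥0∞) : EReal)) (p - 1)
    simpa using this
  calc ENNReal.ofReal ((p - 1) * y)
      = ENNReal.ofReal ((φ p).toReal + ((p - 1) * y - (φ p).toReal)) := by congr 1; ring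
    _ ≤ ENNReal.ofReal (φ p).toReal + ENNReal.ofReal ((p - 1) * y - (φ p).toReal) :=
        ENNReal.ofReal_add_le
    _ ≤ _ := by rw [ENNReal.ofReal_toReal hp]; gcongr

/-- The conjugate is bounded by any bound of the rational affine pieces. -/
lemma psiStar_le (φ : ℝ → ℝ≥0∞)
    (hconv : ∀ x y : ℝ, ∀ a b : ℝ≥0, a + b = 1 →
      φ ((a : ℝ) * x + (b : ℝ) * y) ≤ (a : ℝ≥0∞) * φ x + (b : ℝ≥0∞) * φ y)
    (hone : φ 1 = 0) (y : ℝ) (c : ℝ≥0∞)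
    (h : ∀ q : ℚ, φ ((q : ℝ) + 1) ≠ ⊤ →
      ENNReal.ofReal ((q : ℝ) * y - (φ ((q : ℝ) + 1)).toReal) ≤ c) :
    psiStar φ y ≤ c := by
  apply erealToENNReal_le
  refine iSup_le fun x => ?_
  by_cases hx : φ (x + 1) = ⊤
  · rw [hx]; simp
  by_cases hc : c = ⊤
  · simp [hc]
  rw [coe_sub_of_ne_top _ hx]
  lift c to ℝ≥0 using hc
  have key : x * y - (φ (x + 1)).toReal ≤ (c : ℝ) := by
    by_contra! hlt
    set w := x * y - (φ (x + 1)).toReal with hw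
    have hw0 : 0 < w := lt_of_le_of_lt c.2 hlt
    have hx0 : x ≠ 0 := by
      rintro rfl
      simp at hw
      have : 0 ≤ (φ 1).toReal := ENNReal.toReal_nonneg
      linarith
    have hcw : (c : ℝ) / w < 1 := by rw [div_lt_one hw0]; exact hlt
    have hcw0 : 0 ≤ (c : ℝ) / w := div_nonneg c.2 hw0.le
    obtain ⟨a, q, hqa, ha1, ha2⟩ : ∃ (a : ℝ) (q : ℚ), (q : ℝ) = a * x ∧ (c : ℝ) / w < a ∧ a < 1 := by
      rcases lt_or_gt_of_ne hx0 with hneg | hpos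
      · obtain ⟨q, hq1, hq2⟩ := exists_rat_btwn (show x < (c : ℝ) / w * x by nlinarith)
        refine ⟨q / x, q, by field_simp, ?_, ?_⟩
        · rw [lt_div_iff_of_neg hneg]; exact hq2
        · rw [div_lt_one_of_neg hneg]; exact hq1
      · obtain ⟨q, hq1, hq2⟩ := exists_rat_btwn (show (c : ℝ) / w * x < x by nlinarith)
        refine ⟨q / x, q, by field_simp, ?_, ?_⟩
        · rw [lt_div_iff₀ hpos]; exact hq1
        · rw [div_lt_one hpos]; exact hq2
    have ha0 : 0 ≤ a := hcw0.trans ha1.le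
    have hle : φ ((q : ℝ) + 1) ≤ ENNReal.ofReal a * φ (x + 1) := by
      have := hconv (x + 1) 1 a.toNNReal (1 - a).toNNReal (by
        rw [← Real.toNNReal_add ha0 (by linarith)]; simp)
      rw [hone, mul_zero, add_zero, Real.coe_toNNReal _ ha0,
        Real.coe_toNNReal _ (by linarith)] at this
      have e : (q : ℝ) + 1 = a * (x + 1) + (1 - a) * 1 := by rw [hqa]; ring
      rw [e]
      exact this
    have hfin : ENNReal.ofReal a * φ (x + 1) ≠ ⊤ := ENNReal.mul_ne_top ENNReal.ofReal_ne_top hx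
    have h1 : (φ ((q : ℝ) + 1)).toReal ≤ a * (φ (x + 1)).toReal := by
      have := ENNReal.toReal_mono hfin hle
      rwa [ENNReal.toReal_mul, ENNReal.toReal_ofReal ha0] at this
    have h2 := h q (ne_top_of_le_ne_top hfin hle)
    have h3 : (q : ℝ) * y - (φ ((q : ℝ) + 1)).toReal ≤ c := by
      simpa [ENNReal.ofReal_le_iff_le_toReal] using h2
    have h4 : (c : ℝ) < a * w := by rwa [div_lt_iff₀ hw0] at ha1
    rw [hqa] at h3
    rw [hw] at h4
    rw [hqa] at h1
    nlinarith
  exact EReal.coe_le_coe_iff.2 key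

/-- Admissible densities. -/
structure Adm {Ω : Type*} [MeasurableSpace Ω] (φ : ℝ → ℝ≥0∞)
    (ν : Measure Ω) (g : Ω → ℝ) (p : Ω → ℝ) : Prop where
  meas : Measurable p
  nonneg : ∀ ω, 0 ≤ p ω
  int : Integrable p ν
  intg : Integrable (fun ω => g ω * p ω) ν
  fin : ∫⁻ ω, φ (p ω) ∂ν ≠ ⊤

section adm
variable {Ω : Type*} [MeasurableSpace Ω] {φ : ℝ → ℝ≥0∞} {ν : Measure Ω} {g : Ω → ℝ}

lemma Adm.comb
    (hconv : ∀ x y : ℝ, ∀ a b : ℝ≥0, a + b = 1 →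
      φ ((a : ℝ) * x + (b : ℝ) * y) ≤ (a : ℝ≥0∞) * φ x + (b : ℝ≥0∞) * φ y)
    (hlsc : LowerSemicontinuous φ) {p p' : Ω → ℝ} (hp : Adm φ ν g p) (hp' : Adm φ ν g p')
    {a b : ℝ} (ha : 0 ≤ a) (hb : 0 ≤ b) (hab : a + b = 1) :
    Adm φ ν g (fun ω => a * p ω + b * p' ω) ∧
    (∫⁻ ω, φ (a * p ω + b * p' ω) ∂ν).toReal ≤
      a * (∫⁻ ω, φ (p ω) ∂ν).toReal + b * (∫⁻ ω, φ (p' ω) ∂ν).toReal ∧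
    ∫ ω, (a * p ω + b * p' ω) ∂ν = a * ∫ ω, p ω ∂ν + b * ∫ ω, p' ω ∂ν ∧
    ∫ ω, g ω * (a * p ω + b * p' ω) ∂ν =
      a * ∫ ω, g ω * p ω ∂ν + b * ∫ ω, g ω * p' ω ∂ν := by
  lift a to ℝ≥0 using ha
  lift b to ℝ≥0 using hb
  have hab' : a + b = 1 := by exact_mod_cast hab
  have hmeas : Measurable φ := hlsc.measurable
  have h1 : ∫⁻ ω, φ (a * p ω + b * p' ω) ∂ν ≤
      a * ∫⁻ ω, φ (p ω) ∂ν + b * ∫⁻ ω, φ (p' ω) ∂ν := by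
    have m1 : Measurable fun ω => φ (p ω) := hmeas.comp hp.meas
    have m2 : Measurable fun ω => φ (p' ω) := hmeas.comp hp'.meas
    rw [← lintegral_const_mul _ m1, ← lintegral_const_mul _ m2,
      ← lintegral_add_left (m1.const_mul _)]
    exact lintegral_mono fun ω => hconv _ _ a b hab'
  have h2 : (a : ℝ≥0∞) * ∫⁻ ω, φ (p ω) ∂ν ≠ ⊤ := ENNReal.mul_ne_top (by simp) hp.fin
  have h3 : (b : ℝ≥0∞) * ∫⁻ ω, φ (p' ω) ∂ν ≠ ⊤ := ENNReal.mul_ne_top (by simp) hp'.fin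
  have h4 := ENNReal.add_ne_top.2 ⟨h2, h3⟩
  have e : (fun ω => g ω * (a * p ω + b * p' ω)) =
      fun ω => (a : ℝ) * (g ω * p ω) + (b : ℝ) * (g ω * p' ω) := by ext; ring
  refine ⟨⟨?_, ?_, ?_, ?_, ?_⟩, ?_, ?_, ?_⟩
  · exact (hp.meas.const_mul _).add (hp'.meas.const_mul _)
  · intro ω
    have := hp.nonneg ω
    have := hp'.nonneg ω
    positivity
  · exact (hp.int.const_mul _).add (hp'.int.const_mul _)
  · rw [e]; exact (hp.intg.const_mul _).add (hp'.intg.const_mul _)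
  · exact ne_top_of_le_ne_top h4 h1
  · have := ENNReal.toReal_mono h4 h1
    rw [ENNReal.toReal_add h2 h3, ENNReal.toReal_mul, ENNReal.toReal_mul] at this
    simpa using this
  · rw [integral_add (hp.int.const_mul _) (hp'.int.const_mul _), integral_const_mul,
      integral_const_mul]
  · rw [e, integral_add (hp.intg.const_mul _) (hp'.intg.const_mul _), integral_const_mul,
      integral_const_mul]

lemma adm_const [IsProbabilityMeasure ν] (hgint : Integrable g ν) {c : ℝ} (hc : 0 ≤ c)
    (h : φ c ≠ ⊤) : Adm φ ν g (fun _ => c) := by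
  refine ⟨measurable_const, fun _ => hc, integrable_const _, hgint.mul_const _, ?_⟩
  simpa using h

/-- A density of total mass one gives a feasible measure. -/
lemma Adm.measure [IsProbabilityMeasure ν] {p : Ω → ℝ} (hp : Adm φ ν g p)
    (h1 : ∫ ω, p ω ∂ν = 1) :
    ∃ μ : Measure Ω, IsProbabilityMeasure μ ∧ μ ≪ ν ∧ Integrable g μ ∧
      ∫ ω, g ω ∂μ = ∫ ω, g ω * p ω ∂ν ∧ divAC φ μ ν = ∫⁻ ω, φ (p ω) ∂ν := by
  have hm : Measurable (fun ω => ENNReal.ofReal (p ω)) := hp.meas.ennreal_ofReal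
  have hlt : ∀ᵐ ω ∂ν, ENNReal.ofReal (p ω) < ⊤ := by simp
  have hto : ∀ ω, (ENNReal.ofReal (p ω)).toReal = p ω := fun ω =>
    ENNReal.toReal_ofReal (hp.nonneg ω)
  refine ⟨ν.withDensity fun ω => ENNReal.ofReal (p ω), ⟨?_⟩, withDensity_absolutelyContinuous _ _,
    ?_, ?_, ?_⟩
  · rw [withDensity_apply _ MeasurableSet.univ, Measure.restrict_univ,
      ← ofReal_integral_eq_lintegral_ofReal hp.int (ae_of_all _ hp.nonneg), h1, ENNReal.ofReal_one]
  · rw [integrable_withDensity_iff hm hlt]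
    simpa only [hto] using hp.intg
  · rw [integral_withDensity_eq_integral_toReal_smul hm hlt]
    simp only [hto, smul_eq_mul, mul_comm]
  · unfold divAC
    refine lintegral_congr_ae ?_
    filter_upwards [Measure.rnDeriv_withDensity ν hm] with ω hω
    rw [hω, hto]

/-- A feasible measure of finite divergence gives an admissible density. -/
lemma adm_rnDeriv [IsProbabilityMeasure ν] {μ : Measure Ω} [IsProbabilityMeasure μ]
    (hac : μ ≪ ν) (hi : Integrable g μ) (hfin : divAC φ μ ν ≠ ⊤) :
    Adm φ ν g (fun ω => (μ.rnDeriv ν ω).toReal) ∧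
    ∫ ω, (μ.rnDeriv ν ω).toReal ∂ν = 1 ∧
    ∫ ω, g ω * (μ.rnDeriv ν ω).toReal ∂ν = ∫ ω, g ω ∂μ := by
  refine ⟨⟨(Measure.measurable_rnDeriv μ ν).ennreal_toReal, fun _ => ENNReal.toReal_nonneg,
    Measure.integrable_toReal_rnDeriv, ?_, hfin⟩, ?_, ?_⟩
  · have := (integrable_rnDeriv_smul_iff hac).2 hi
    simpa only [smul_eq_mul, mul_comm] using this
  · rw [Measure.integral_toReal_rnDeriv hac]; simp
  · have := integral_rnDeriv_smul hac (f := g)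
    rw [← this]
    simp only [smul_eq_mul, mul_comm]

/-- Weak duality. -/
lemma Adm.weak [IsProbabilityMeasure ν] (hlsc : LowerSemicontinuous φ) (hgint : Integrable g ν)
    {p : Ω → ℝ} (hp : Adm φ ν g p) (h1 : ∫ ω, p ω ∂ν = 1) (t : ℝ) :
    ENNReal.ofReal (t * (∫ ω, g ω * p ω ∂ν - ∫ ω, g ω ∂ν)) ≤
      ∫⁻ ω, φ (p ω) ∂ν + cgf φ ν g t := by
  unfold cgf
  rw [ENNReal.add_iInf]
  refine le_iInf fun l => ?_
  have e : (fun ω => (p ω - 1) * (t * g ω + l)) =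
      fun ω => t * (g ω * p ω - g ω) + l * (p ω - 1) := by ext; ring
  have hi1 : Integrable (fun ω => t * (g ω * p ω - g ω)) ν := (hp.intg.sub hgint).const_mul _
  have hi2 : Integrable (fun ω => l * (p ω - 1)) ν := (hp.int.sub (integrable_const _)).const_mul _
  have e2 : ∫ ω, (p ω - 1) * (t * g ω + l) ∂ν = t * (∫ ω, g ω * p ω ∂ν - ∫ ω, g ω ∂ν) := by
    rw [e, integral_add hi1 hi2, integral_const_mul, integral_const_mul,
      integral_sub hp.intg hgint, integral_sub hp.int (integrable_const _), h1]
    simp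
  have hmeas : Measurable (fun ω => φ (p ω)) := hlsc.measurable.comp hp.meas
  rw [← e2, ← lintegral_add_left hmeas]
  refine le_trans ?_ (lintegral_mono fun ω => fenchel_young φ (p ω) (t * g ω + l))
  have hi : Integrable (fun ω => (p ω - 1) * (t * g ω + l)) ν := by
    rw [e]; exact hi1.add hi2
  calc ENNReal.ofReal (∫ ω, (p ω - 1) * (t * g ω + l) ∂ν)
      ≤ ENNReal.ofReal (∫ ω, max ((p ω - 1) * (t * g ω + l)) 0 ∂ν) :=
        ENNReal.ofReal_le_ofReal (integral_mono hi hi.pos_part fun ω => le_max_left _ _)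
    _ = ∫⁻ ω, ENNReal.ofReal (max ((p ω - 1) * (t * g ω + l)) 0) ∂ν :=
        ofReal_integral_eq_lintegral_ofReal hi.pos_part (ae_of_all _ fun ω => le_max_right _ _)
    _ = _ := by simp

/-- From a Lagrangian lower bound on all densities to a bound on the conjugate integral. -/
lemma lintegral_psiStar_le [IsProbabilityMeasure ν]
    (hconv : ∀ x y : ℝ, ∀ a b : ℝ≥0, a + b = 1 →
      φ ((a : ℝ) * x + (b : ℝ) * y) ≤ (a : ℝ≥0∞) * φ x + (b : ℝ≥0∞) * φ y)
    (hneg : ∀ x : ℝ, x < 0 → φ x = ⊤)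
    (hone : φ 1 = 0) (hg : Measurable g) (hgint : Integrable g ν) (t l C : ℝ)
    (h : ∀ p, Adm φ ν g p → t * (∫ ω, g ω * p ω ∂ν - ∫ ω, g ω ∂ν) + l * (∫ ω, p ω ∂ν - 1)
      - (∫⁻ ω, φ (p ω) ∂ν).toReal ≤ C) :
    ∫⁻ ω, psiStar φ (t * g ω + l) ∂ν ≤ ENNReal.ofReal C := by
  classical
  let Q : Set ℚ := {q | φ ((q : ℝ) + 1) ≠ ⊤}
  have hQ : Q.Nonempty := ⟨0, by simp [Q, hone]⟩
  obtain ⟨q, hq⟩ := (Set.to_countable Q).exists_eq_range hQ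
  have hqQ : ∀ n, φ ((q n : ℝ) + 1) ≠ ⊤ := fun n => by
    have : q n ∈ Q := hq ▸ Set.mem_range_self n
    exact this
  let a : ℕ → Ω → ℝ := fun n ω => (q n : ℝ) * (t * g ω + l) - (φ ((q n : ℝ) + 1)).toReal
  have ham : ∀ n, Measurable (a n) := fun n => by
    exact (((hg.const_mul _).add_const _).const_mul _).sub_const _
  let f : ℕ → Ω → ℝ := fun n => Nat.rec (fun _ => 0) (fun k fk ω => max (fk ω) (a k ω)) n
  have f0 : ∀ ω, f 0 ω = 0 := fun ω => rfl
  have fs : ∀ n ω, f (n + 1) ω = max (f n ω) (a n ω) := fun n ω => rfl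
  have hsel : ∀ n, Measurable (f n) ∧ ∃ x : SimpleFunc Ω ℝ, (∀ ω, φ (x ω + 1) ≠ ⊤) ∧
      ∀ ω, f n ω = x ω * (t * g ω + l) - (φ (x ω + 1)).toReal := by
    intro n
    induction n with
    | zero => 
      refine ⟨measurable_const, SimpleFunc.const Ω 0, ?_, ?_⟩
      · intro ω; simp [hone]
      · intro ω; simp [hone, f0]
    | succ n ih =>
      obtain ⟨hm, x, hx, hfx⟩ := ih
      have hset : MeasurableSet {ω | f n ω < a n ω} := measurableSet_lt hm (ham n)
      have hv : ∀ ω, f n ω < a n ω →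
          (SimpleFunc.piecewise _ hset (SimpleFunc.const Ω (q n : ℝ)) x) ω = q n := by
        intro ω hω
        rw [SimpleFunc.piecewise_apply]
        exact if_pos hω
      have hv' : ∀ ω, a n ω ≤ f n ω →
          (SimpleFunc.piecewise _ hset (SimpleFunc.const Ω (q n : ℝ)) x) ω = x ω := by
        intro ω hω
        rw [SimpleFunc.piecewise_apply]
        exact if_neg (not_lt.2 hω)
      refine ⟨hm.max (ham n), SimpleFunc.piecewise _ hset (SimpleFunc.const Ω (q n : ℝ)) x, ?_, ?_⟩
      · intro ω
        rcases lt_or_ge (f n ω) (a n ω) with hω | hω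
        · rw [hv ω hω]; exact hqQ n
        · rw [hv' ω hω]; exact hx ω
      · intro ω
        rw [fs]
        rcases lt_or_ge (f n ω) (a n ω) with hω | hω
        · rw [hv ω hω, max_eq_right hω.le]
        · rw [hv' ω hω, max_eq_left hω, hfx]
  have hmono : Monotone f := monotone_nat_of_le_succ fun n ω => by
    rw [fs]; exact le_max_left _ _
  have hnn : ∀ n ω, 0 ≤ f n ω := fun n ω => by
    have := hmono (Nat.zero_le n) ω
    rwa [f0] at this
  have hle : ∀ n, ∫⁻ ω, ENNReal.ofReal (f n ω) ∂ν ≤ ENNReal.ofReal C := by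
    intro n
    obtain ⟨hm, x, hx, hfx⟩ := hsel n
    obtain ⟨B, hB⟩ := x.exists_forall_norm_le
    let d : SimpleFunc Ω ℝ := x.map fun x => (φ (x + 1)).toReal
    have hd : ∀ ω, d ω = (φ (x ω + 1)).toReal := fun ω => rfl
    have hdi : Integrable d ν := SimpleFunc.integrable_of_isFiniteMeasure d
    have hxi : Integrable x ν := SimpleFunc.integrable_of_isFiniteMeasure x
    have hgx : Integrable (fun ω => g ω * x ω) ν :=
      hgint.mul_bdd x.aestronglyMeasurable (ae_of_all _ hB)
    have hlin : ∫⁻ ω, φ (x ω + 1) ∂ν = ENNReal.ofReal (∫ ω, d ω ∂ν) := by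
      rw [ofReal_integral_eq_lintegral_ofReal hdi (ae_of_all _ fun ω => by
        rw [hd]; exact ENNReal.toReal_nonneg)]
      refine lintegral_congr fun ω => ?_
      rw [hd, ENNReal.ofReal_toReal (hx ω)]
    have hd0 : 0 ≤ ∫ ω, d ω ∂ν := integral_nonneg fun ω => by
        rw [hd]; exact ENNReal.toReal_nonneg
    have e1 : (fun ω => g ω * (x ω + 1)) = fun ω => g ω * x ω + g ω := by ext; ring
    have hadm : Adm φ ν g (fun ω => x ω + 1) := by
      refine ⟨x.measurable.add_const _, ?_, hxi.add (integrable_const _), ?_, ?_⟩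
      · intro ω
        by_contra! hlt
        exact hx ω (hneg _ hlt)
      · rw [e1]
        exact hgx.add hgint
      · rw [hlin]; exact ENNReal.ofReal_ne_top
    have hC := h _ hadm
    rw [hlin, ENNReal.toReal_ofReal hd0, e1, integral_add hgx hgint,
      integral_add hxi (integrable_const _)] at hC
    have e2 : f n = fun ω => (t * (g ω * x ω) + l * x ω) - d ω := by
      ext ω; rw [hfx, hd]; ring
    have hi1 : Integrable (fun ω => t * (g ω * x ω) + l * x ω) ν :=
      (hgx.const_mul _).add (hxi.const_mul _)
    have hfi : Integrable (f n) ν := by rw [e2]; exact hi1.sub hdi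
    rw [← ofReal_integral_eq_lintegral_ofReal hfi (ae_of_all _ (hnn n))]
    apply ENNReal.ofReal_le_ofReal
    rw [e2, integral_sub hi1 hdi, integral_add (hgx.const_mul _) (hxi.const_mul _),
      integral_const_mul, integral_const_mul]
    simp at hC
    linarith
  calc ∫⁻ ω, psiStar φ (t * g ω + l) ∂ν
      ≤ ∫⁻ ω, ⨆ n, ENNReal.ofReal (f n ω) ∂ν := by
        refine lintegral_mono fun ω => ?_
        refine psiStar_le φ hconv hone _ _ fun r hr => ?_
        have : r ∈ Set.range q := hq ▸ hr
        obtain ⟨n, rfl⟩ := this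
        refine le_trans ?_ (le_iSup _ (n + 1))
        apply ENNReal.ofReal_le_ofReal
        rw [fs]; exact le_max_right _ _
    _ = ⨆ n, ∫⁻ ω, ENNReal.ofReal (f n ω) ∂ν := by
        refine lintegral_iSup (fun n => (hsel n).1.ennreal_ofReal) fun n m hnm ω => ?_
        exact ENNReal.ofReal_le_ofReal (hmono hnm ω)
    _ ≤ _ := iSup_le hle

end adm

/-- Convexity across the mean constraint. -/
lemma mean_cross {Ω : Type*} [MeasurableSpace Ω] {φ : ℝ → ℝ≥0∞}
    {ν : Measure Ω} {g : Ω → ℝ}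
    (hconv : ∀ x y : ℝ, ∀ a b : ℝ≥0, a + b = 1 →
      φ ((a : ℝ) * x + (b : ℝ) * y) ≤ (a : ℝ≥0∞) * φ x + (b : ℝ≥0∞) * φ y)
    (hlsc : LowerSemicontinuous φ) {ε r : ℝ}
    (h0 : ∀ p, Adm φ ν g p → ∫ ω, p ω ∂ν = 1 → ∫ ω, g ω * p ω ∂ν - ∫ ω, g ω ∂ν = ε →
      r ≤ (∫⁻ ω, φ (p ω) ∂ν).toReal)
    {p p' : Ω → ℝ} (hp : Adm φ ν g p) (h1 : ∫ ω, p ω ∂ν = 1)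
    (hp' : Adm φ ν g p') (h1' : ∫ ω, p' ω ∂ν = 1)
    (hm : 0 < ∫ ω, g ω * p ω ∂ν - ∫ ω, g ω ∂ν - ε)
    (hm' : ∫ ω, g ω * p' ω ∂ν - ∫ ω, g ω ∂ν - ε < 0) :
    0 ≤ -(∫ ω, g ω * p' ω ∂ν - ∫ ω, g ω ∂ν - ε) * ((∫⁻ ω, φ (p ω) ∂ν).toReal - r) +
      (∫ ω, g ω * p ω ∂ν - ∫ ω, g ω ∂ν - ε) * ((∫⁻ ω, φ (p' ω) ∂ν).toReal - r) := by
  set e := ∫ ω, g ω * p ω ∂ν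
  set e' := ∫ ω, g ω * p' ω ∂ν
  set E := ∫ ω, g ω ∂ν
  have hs : 0 < e - e' := by linarith
  obtain ⟨c1, c2, c3, c4⟩ := hp.comb hconv hlsc hp' (a := -(e' - E - ε) / (e - e'))
    (b := (e - E - ε) / (e - e')) (div_nonneg (by linarith) hs.le)
    (div_nonneg (by linarith) hs.le) (by field_simp; ring)
  have := h0 _ c1 (by rw [c3, h1, h1']; field_simp; ring)
    (by rw [c4]; change _ * e + _ * e' - E = ε; field_simp; ring)
  have h5 := this.trans c2
  have h6 := mul_le_mul_of_nonneg_left h5 hs.le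
  have h7 : (e - e') * (-(e' - E - ε) / (e - e') * (∫⁻ ω, φ (p ω) ∂ν).toReal +
    (e - E - ε) / (e - e') * (∫⁻ ω, φ (p' ω) ∂ν).toReal) =
    -(e' - E - ε) * (∫⁻ ω, φ (p ω) ∂ν).toReal + (e - E - ε) * (∫⁻ ω, φ (p' ω) ∂ν).toReal := by
    field_simp
  rw [h7] at h6
  linarith

/-- Lower bound half, assuming the slopes at `ε` are bounded. -/
lemma strong_aux {Ω : Type*} [MeasurableSpace Ω] (φ : ℝ → ℝ≥0∞)
    (hconv : ∀ x y : ℝ, ∀ a b : ℝ≥0, a + b = 1 →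
      φ ((a : ℝ) * x + (b : ℝ) * y) ≤ (a : ℝ≥0∞) * φ x + (b : ℝ≥0∞) * φ y)
    (hlsc : LowerSemicontinuous φ)
    (hneg : ∀ x : ℝ, x < 0 → φ x = ⊤)
    (hone : φ 1 = 0)
    (hdom : (1 : ℝ) ∈ interior {x : ℝ | φ x ≠ ⊤})
    (ν : Measure Ω) [IsProbabilityMeasure ν]
    (g : Ω → ℝ) (hg : Measurable g) (hgint : Integrable g ν) (ε r : ℝ)
    (h0 : ∀ p, Adm φ ν g p → ∫ ω, p ω ∂ν = 1 → ∫ ω, g ω * p ω ∂ν - ∫ ω, g ω ∂ν = ε →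
      r ≤ (∫⁻ ω, φ (p ω) ∂ν).toReal)
    (hA : ∃ A : ℝ, ∀ p, Adm φ ν g p → ∫ ω, p ω ∂ν = 1 →
      0 < ∫ ω, g ω * p ω ∂ν - ∫ ω, g ω ∂ν - ε →
      A * (∫ ω, g ω * p ω ∂ν - ∫ ω, g ω ∂ν - ε) ≤ (∫⁻ ω, φ (p ω) ∂ν).toReal - r)
    (hB : ∃ A : ℝ, ∀ p, Adm φ ν g p → ∫ ω, p ω ∂ν = 1 →
      ∫ ω, g ω * p ω ∂ν - ∫ ω, g ω ∂ν - ε < 0 →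
      A * (∫ ω, g ω * p ω ∂ν - ∫ ω, g ω ∂ν - ε) ≤ (∫⁻ ω, φ (p ω) ∂ν).toReal - r) :
    (r : EReal) ≤ ⨆ t : ℝ, ((t * ε : ℝ) : EReal) - ((cgf φ ν g t : ℝ≥0∞) : EReal) := by
  -- multiplier for the mean constraint
  obtain ⟨t, ht⟩ := exists_slope {p | Adm φ ν g p ∧ ∫ ω, p ω ∂ν = 1}
    (fun p => ∫ ω, g ω * p ω ∂ν - ∫ ω, g ω ∂ν - ε) (fun p => (∫⁻ ω, φ (p ω) ∂ν).toReal - r)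
    (by
      rintro p ⟨hp, h1⟩ hm
      have := h0 p hp h1 (by linarith)
      linarith)
    (by
      rintro p ⟨hp, h1⟩ p' ⟨hp', h1'⟩ hm hm'
      exact mean_cross hconv hlsc h0 hp h1 hp' h1' hm hm')
    (by
      obtain ⟨A, hA⟩ := hA
      exact ⟨A, fun p hp => hA p hp.1 hp.2⟩)
    (by
      obtain ⟨A, hA⟩ := hB
      exact ⟨A, fun p hp => hA p hp.1 hp.2⟩)
  -- multiplier for the mass constraint
  have hcross : ∀ p ∈ {p | Adm φ ν g p}, ∀ p' ∈ {p | Adm φ ν g p},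
      0 < ∫ ω, p ω ∂ν - 1 → ∫ ω, p' ω ∂ν - 1 < 0 →
      0 ≤ -(∫ ω, p' ω ∂ν - 1) * ((∫⁻ ω, φ (p ω) ∂ν).toReal - r -
          t * (∫ ω, g ω * p ω ∂ν - ∫ ω, g ω ∂ν - ε)) +
        (∫ ω, p ω ∂ν - 1) * ((∫⁻ ω, φ (p' ω) ∂ν).toReal - r -
          t * (∫ ω, g ω * p' ω ∂ν - ∫ ω, g ω ∂ν - ε)) := by
    intro p hp p' hp' hm hm'
    set e := ∫ ω, g ω * p ω ∂ν
    set e' := ∫ ω, g ω * p' ω ∂ν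
    set E := ∫ ω, g ω ∂ν
    set m := ∫ ω, p ω ∂ν
    set m' := ∫ ω, p' ω ∂ν
    have hs : 0 < m - m' := by linarith
    obtain ⟨c1, c2, c3, c4⟩ := hp.comb hconv hlsc hp' (a := -(m' - 1) / (m - m'))
      (b := (m - 1) / (m - m')) (div_nonneg (by linarith) hs.le)
      (div_nonneg (by linarith) hs.le) (by field_simp; ring)
    have := ht _ ⟨c1, by rw [c3]; change _ * m + _ * m' = 1; field_simp; ring⟩
    rw [c4] at this
    change t * (_ * e + _ * e' - E - ε) ≤ _ at this
    have h5 := this.trans (sub_le_sub_right c2 r)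
    have h6 := mul_le_mul_of_nonneg_left h5 hs.le
    have h7 : (m - m') * (-(m' - 1) / (m - m') * (∫⁻ ω, φ (p ω) ∂ν).toReal +
        (m - 1) / (m - m') * (∫⁻ ω, φ (p' ω) ∂ν).toReal - r) =
        -(m' - 1) * (∫⁻ ω, φ (p ω) ∂ν).toReal + (m - 1) * (∫⁻ ω, φ (p' ω) ∂ν).toReal
        - (m - m') * r := by
        field_simp
    have h8 : (m - m') * (t * (-(m' - 1) / (m - m') * e +
        (m - 1) / (m - m') * e' - E - ε)) =
        t * (-(m' - 1) * e + (m - 1) * e' - (m - m') * (E + ε)) := by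
        field_simp; ring
    rw [h7, h8] at h6
    linarith
  obtain ⟨δ, hδ, hball⟩ := Metric.mem_nhds_iff.1 (mem_interior_iff_mem_nhds.1 hdom)
  have hconst : ∀ c : ℝ, |c - 1| < δ → Adm φ ν g (fun _ => c) := by
    intro c hc
    have : φ c ≠ ⊤ := hball (by simpa [Real.dist_eq] using hc)
    refine adm_const hgint ?_ this
    by_contra! hlt
    exact this (hneg _ hlt)
  have hup := hconst (1 + δ / 2) (by rw [abs_lt]; constructor <;> linarith)
  have hdn := hconst (1 - δ / 2) (by rw [abs_lt]; constructor <;> linarith)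
  have iup : ∫ ω, (fun _ => 1 + δ / 2 : Ω → ℝ) ω ∂ν - 1 = δ / 2 := by simp
  have idn : ∫ ω, (fun _ => 1 - δ / 2 : Ω → ℝ) ω ∂ν - 1 = -(δ / 2) := by simp
  obtain ⟨l, hl⟩ := exists_slope {p | Adm φ ν g p}
    (fun p => ∫ ω, p ω ∂ν - 1) (fun p => (∫⁻ ω, φ (p ω) ∂ν).toReal - r -
          t * (∫ ω, g ω * p ω ∂ν - ∫ ω, g ω ∂ν - ε))
    (by
      intro p hp hm
      have := ht p ⟨hp, by linarith⟩
      linarith)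
    hcross
    (by
      have hX := fun p hp hm => hcross p hp _ hdn hm (by rw [idn]; linarith)
      rw [idn] at hX
      generalize (∫⁻ ω, φ ((fun _ => 1 - δ / 2 : Ω → ℝ) ω) ∂ν).toReal - r -
          t * (∫ ω, g ω * (fun _ => 1 - δ / 2 : Ω → ℝ) ω ∂ν - ∫ ω, g ω ∂ν - ε) = X at hX
      refine ⟨-X / (δ / 2), fun p hp hm => ?_⟩
      have := hX p hp hm
      rw [div_mul_eq_mul_div, div_le_iff₀ (by linarith)]
      linarith)
    (by
      have hX := fun p hp => hcross _ hup p hp (by rw [iup]; linarith)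
      rw [iup] at hX
      generalize (∫⁻ ω, φ ((fun _ => 1 + δ / 2 : Ω → ℝ) ω) ∂ν).toReal - r -
          t * (∫ ω, g ω * (fun _ => 1 + δ / 2 : Ω → ℝ) ω ∂ν - ∫ ω, g ω ∂ν - ε) = X at hX
      refine ⟨X / (δ / 2), fun p hp hm => ?_⟩
      have := hX p hp hm
      rw [div_mul_eq_mul_div, div_le_iff₀ (by linarith)]
      linarith)
  have hpsi := lintegral_psiStar_le hconv hneg hone hg hgint t l (t * ε - r) (by
    intro p hp
    have := hl p hp
    linarith)
  have hC : 0 ≤ t * ε - r := by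
    have := hl _ (hconst 1 (by simpa using hδ))
    simp [hone] at this
    linarith
  refine le_iSup_of_le t ?_
  have hcgf : cgf φ ν g t ≤ ENNReal.ofReal (t * ε - r) := (iInf_le _ l).trans hpsi
  have hne : cgf φ ν g t ≠ ⊤ := ne_top_of_le_ne_top ENNReal.ofReal_ne_top hcgf
  rw [coe_sub_of_ne_top _ hne]
  have := ENNReal.toReal_mono ENNReal.ofReal_ne_top hcgf
  rw [ENNReal.toReal_ofReal hC] at this
  exact EReal.coe_le_coe_iff.2 (by linarith)

/-- **Optimal lower bound of the φ-divergence in terms of the mean deviation of a single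
function, via convex duality.**  Let `ν` be a probability measure and `g ∈ L¹(ν)`.  Let
`L(ε)` be the infimum of `D_φ(μ‖ν)` over probability measures `μ ≪ ν` integrating `g`
with `∫ g dμ − ∫ g dν = ε` (infimum of the empty set being `+∞`).  Then for every `ε` in
the interior of `{ε : L(ε) < ∞}` one has `L(ε) = sup_t (t·ε − Λ_{g,ν}(t))`; moreover if
`L` is lower semicontinuous then this holds for every `ε ∈ ℝ`. -/
theorem optimal_lower_bound_single_g {Ω : Type*} [MeasurableSpace Ω] (φ : ℝ → ℝ≥0∞)
    (hconv : ∀ x y : ℝ, ∀ a b : ℝ≥0, a + b = 1 →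
      φ ((a : ℝ) * x + (b : ℝ) * y) ≤ (a : ℝ≥0∞) * φ x + (b : ℝ≥0∞) * φ y)
    (hlsc : LowerSemicontinuous φ)
    (hneg : ∀ x : ℝ, x < 0 → φ x = ⊤)
    (hone : φ 1 = 0)
    (hdom : (1 : ℝ) ∈ interior {x : ℝ | φ x ≠ ⊤})
    (ν : Measure Ω) [IsProbabilityMeasure ν]
    (g : Ω → ℝ) (hg : Measurable g) (hgint : Integrable g ν)
    (L : ℝ → ℝ≥0∞)
    (hL : ∀ ε : ℝ, L ε =
      ⨅ (μ : Measure Ω) (_ : IsProbabilityMeasure μ ∧ μ ≪ ν ∧ Integrable g μ ∧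
          ∫ ω, g ω ∂μ - ∫ ω, g ω ∂ν = ε), divAC φ μ ν) :
    (∀ ε ∈ interior {ε : ℝ | L ε ≠ ⊤},
        (L ε : EReal) = ⨆ t : ℝ, ((t * ε : ℝ) : EReal) - ((cgf φ ν g t : ℝ≥0∞) : EReal))
    ∧ (LowerSemicontinuous L → ∀ ε : ℝ,
        (L ε : EReal) = ⨆ t : ℝ, ((t * ε : ℝ) : EReal) - ((cgf φ ν g t : ℝ≥0∞) : EReal)) := by
  have hLp : ∀ p, Adm φ ν g p → ∫ ω, p ω ∂ν = 1 →
      L (∫ ω, g ω * p ω ∂ν - ∫ ω, g ω ∂ν) ≤ ∫⁻ ω, φ (p ω) ∂ν := by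
    intro p hp h1
    obtain ⟨μ, i1, i2, i3, i4, i5⟩ := hp.measure h1
    rw [hL, ← i5]
    exact iInf₂_le μ ⟨i1, i2, i3, by rw [i4]⟩
  have hLp' : ∀ ε, L ε ≠ ⊤ → ∃ p, Adm φ ν g p ∧ ∫ ω, p ω ∂ν = 1 ∧
      ∫ ω, g ω * p ω ∂ν - ∫ ω, g ω ∂ν = ε := by
    intro ε hε
    rw [hL] at hε
    by_contra! hno
    refine hε ?_
    simp only [iInf_eq_top]
    rintro μ ⟨i1, i2, i3, i4⟩
    by_contra hfin
    obtain ⟨j1, j2, j3⟩ := adm_rnDeriv (g := g) i2 i3 hfin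
    exact hno _ j1 j2 (by rw [j3, i4])
  have weak : ∀ ε, (⨆ t : ℝ, ((t * ε : ℝ) : EReal) - ((cgf φ ν g t : ℝ≥0∞) : EReal)) ≤ L ε := by
    intro ε
    refine iSup_le fun t => ?_
    have hw : ENNReal.ofReal (t * ε) ≤ L ε + cgf φ ν g t := by
      rw [hL, ENNReal.iInf_add]
      refine le_iInf fun μ => ?_
      rw [ENNReal.iInf_add]
      refine le_iInf fun hμ => ?_
      obtain ⟨i1, i2, i3, i4⟩ := hμ
      by_cases hfin : divAC φ μ ν = ⊤
      · simp [hfin]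
      obtain ⟨j1, j2, j3⟩ := adm_rnDeriv (g := g) i2 i3 hfin
      have := j1.weak hlsc hgint j2 t
      rw [j3, i4] at this
      exact this
    by_cases hc : cgf φ ν g t = ⊤
    · rw [hc]; simp
    by_cases hl : L ε = ⊤
    · rw [hl]; simp
    rw [coe_sub_of_ne_top _ hc]
    rw [ENNReal.ofReal_le_iff_le_toReal (ENNReal.add_ne_top.2 ⟨hl, hc⟩),
      ENNReal.toReal_add hl hc] at hw
    rw [← ENNReal.ofReal_toReal hl, EReal.coe_ennreal_ofReal, max_eq_left ENNReal.toReal_nonneg]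
    exact EReal.coe_le_coe_iff.2 (by linarith)
  have h0 : ∀ ε (r : ℝ≥0), (r : ℝ≥0∞) < L ε → ∀ p, Adm φ ν g p → ∫ ω, p ω ∂ν = 1 →
      ∫ ω, g ω * p ω ∂ν - ∫ ω, g ω ∂ν = ε → (r : ℝ) ≤ (∫⁻ ω, φ (p ω) ∂ν).toReal := by
    intro ε r hr p hp h1 he
    have := hr.le.trans (he ▸ hLp p hp h1)
    simpa using ENNReal.toReal_mono hp.fin this
  have fin : ∀ ε, (∀ r : ℝ≥0, (r : ℝ≥0∞) < L ε → ((r : ℝ) : EReal) ≤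
      ⨆ t : ℝ, ((t * ε : ℝ) : EReal) - ((cgf φ ν g t : ℝ≥0∞) : EReal)) →
      (L ε : EReal) = ⨆ t : ℝ, ((t * ε : ℝ) : EReal) - ((cgf φ ν g t : ℝ≥0∞) : EReal) := by
    intro ε h
    refine le_antisymm ?_ (weak ε)
    have hc0 : cgf φ ν g 0 = 0 := by
      refine le_antisymm ((iInf_le _ 0).trans ?_) zero_le
      have : psiStar φ 0 = 0 := by
        refine le_antisymm (psiStar_le φ hconv hone _ _ fun q hq => ?_) zero_le
        simp
      simp [this]
    have hnn : (0 : EReal) ≤ ⨆ t : ℝ, ((t * ε : ℝ) : EReal) - ((cgf φ ν g t : ℝ≥0∞) : EReal) := by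
      refine le_iSup_of_le 0 ?_
      simp [hc0]
    generalize (⨆ t : ℝ, ((t * ε : ℝ) : EReal) - ((cgf φ ν g t : ℝ≥0∞) : EReal)) = s at h hnn
    rw [← EReal.coe_toENNReal hnn]
    rw [EReal.coe_ennreal_le_coe_ennreal_iff]
    refine ENNReal.le_of_forall_nnreal_lt fun r hr => ?_
    have := h r hr
    rw [← EReal.coe_toENNReal hnn] at this
    exact EReal.coe_ennreal_le_coe_ennreal_iff.1 this
  refine ⟨fun ε hε => fin ε fun r hr => ?_, fun hLs ε => fin ε fun r hr => ?_⟩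
  · obtain ⟨δ, hδ, hball⟩ := Metric.mem_nhds_iff.1 (mem_interior_iff_mem_nhds.1 hε)
    obtain ⟨p1, a1, a2, a3⟩ := hLp' (ε + δ / 2) (hball (by
      simp [abs_of_pos hδ]; linarith))
    obtain ⟨p2, b1, b2, b3⟩ := hLp' (ε - δ / 2) (hball (by
      simp [abs_of_pos hδ]; linarith))
    have hcross : ∀ p p', Adm φ ν g p → ∫ ω, p ω ∂ν = 1 → Adm φ ν g p' → ∫ ω, p' ω ∂ν = 1 →
        0 < ∫ ω, g ω * p ω ∂ν - ∫ ω, g ω ∂ν - ε → ∫ ω, g ω * p' ω ∂ν - ∫ ω, g ω ∂ν - ε < 0 →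
        0 ≤ -(∫ ω, g ω * p' ω ∂ν - ∫ ω, g ω ∂ν - ε) * ((∫⁻ ω, φ (p ω) ∂ν).toReal - r) +
          (∫ ω, g ω * p ω ∂ν - ∫ ω, g ω ∂ν - ε) * ((∫⁻ ω, φ (p' ω) ∂ν).toReal - r) :=
      fun p p' hp h1 hp' h1' => mean_cross hconv hlsc (h0 ε r hr) hp h1 hp' h1'
    refine strong_aux φ hconv hlsc hneg hone hdom ν g hg hgint ε r (h0 ε r hr) ?_ ?_
    · refine ⟨-((∫⁻ ω, φ (p2 ω) ∂ν).toReal - r) / (δ / 2), fun p hp h1 hm => ?_⟩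
      have := hcross p p2 hp h1 b1 b2 hm (by rw [b3]; linarith)
      rw [b3] at this
      rw [div_mul_eq_mul_div, div_le_iff₀ (by linarith)]
      linarith
    · refine ⟨((∫⁻ ω, φ (p1 ω) ∂ν).toReal - r) / (δ / 2), fun p hp h1 hm => ?_⟩
      have := hcross p1 p a1 a2 hp h1 (by rw [a3]; linarith) hm
      rw [a3] at this
      rw [div_mul_eq_mul_div, div_le_iff₀ (by linarith)]
      linarith
  · obtain ⟨δ, hδ, hball⟩ := Metric.eventually_nhds_iff.1 (hLs ε r hr)
    have hnear : ∀ p, Adm φ ν g p → ∫ ω, p ω ∂ν = 1 →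
        |∫ ω, g ω * p ω ∂ν - ∫ ω, g ω ∂ν - ε| < δ → (r : ℝ) ≤ (∫⁻ ω, φ (p ω) ∂ν).toReal := by
      intro p hp h1 hlt
      exact h0 _ r (hball (by rwa [Real.dist_eq])) p hp h1 rfl
    have hr0 : (0 : ℝ) ≤ r := r.2
    refine strong_aux φ hconv hlsc hneg hone hdom ν g hg hgint ε r (h0 ε r hr) ?_ ?_
    · refine ⟨-(r / δ), fun p hp h1 hm => ?_⟩
      have hD : 0 ≤ (∫⁻ ω, φ (p ω) ∂ν).toReal := ENNReal.toReal_nonneg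
      have hq : 0 ≤ (r : ℝ) / δ := by positivity
      rcases lt_or_ge |∫ ω, g ω * p ω ∂ν - ∫ ω, g ω ∂ν - ε| δ with hlt | hge
      · have := hnear p hp h1 hlt
        nlinarith
      · rw [abs_of_pos hm] at hge
        have h2 := mul_le_mul_of_nonneg_left hge hq
        rw [div_mul_cancel₀ _ hδ.ne'] at h2
        linarith
    · refine ⟨r / δ, fun p hp h1 hm => ?_⟩
      have hD : 0 ≤ (∫⁻ ω, φ (p ω) ∂ν).toReal := ENNReal.toReal_nonneg
      have hq : 0 ≤ (r : ℝ) / δ := by positivity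
      rcases lt_or_ge |∫ ω, g ω * p ω ∂ν - ∫ ω, g ω ∂ν - ε| δ with hlt | hge
      · have := hnear p hp h1 hlt
        nlinarith
      · rw [abs_of_neg hm] at hge
        have h2 := mul_le_mul_of_nonneg_left hge hq
        rw [div_mul_cancel₀ _ hδ.ne'] at h2
        linarith
end

section
/- Let ν be a probability measure on (Ω,F) and g : Ω → ℝ measurable. (a) If g is ν-essentially bounded (there is C ∈ ℝ with |g| ≤ C ν-a.e.), then Λ_{g,ν}(t) < ∞ for every t ∈ ℝ. (b) Conversely, if φ'(∞) < ∞ and there exists δ > 0 such that Λ_{g,ν}(t) < ∞ for every t with |t| < δ, then g is ν-essentially bounded. -/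
open MeasureTheory Filter Set
open scoped ENNReal NNReal Topology

theorem psiStar_le_aux (φ : ℝ → ℝ≥0∞) (hneg : ∀ x : ℝ, x < 0 → φ x = ⊤) (y B : ℝ)
    (hy : y ≤ 0) (hB : -y ≤ B) : psiStar φ y ≤ ENNReal.ofReal B := by
  have h : (⨆ x : ℝ, ((x * y : ℝ) : EReal) - ((φ (x + 1) : ℝ≥0∞) : EReal)) ≤ (B : EReal) := by
    refine iSup_le fun x => ?_
    by_cases hx : x + 1 < 0
    · rw [hneg _ hx]
      simp
    · have h1 : ((x * y : ℝ) : EReal) ≤ (B : EReal) := by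
        rw [EReal.coe_le_coe_iff]
        nlinarith
      refine le_trans ?_ h1
      calc ((x * y : ℝ) : EReal) - ((φ (x + 1) : ℝ≥0∞) : EReal)
          ≤ ((x * y : ℝ) : EReal) - 0 := EReal.sub_le_sub le_rfl (EReal.coe_ennreal_nonneg _)
        _ = _ := by simp
  unfold psiStar erealToENNReal
  have hne : (⨆ x : ℝ, ((x * y : ℝ) : EReal) - ((φ (x + 1) : ℝ≥0∞) : EReal)) ≠ ⊤ :=
    ne_top_of_le_ne_top (EReal.coe_ne_top B) h
  rw [if_neg hne]
  apply ENNReal.ofReal_le_ofReal_iff'.2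
  by_cases hb : (⨆ x : ℝ, ((x * y : ℝ) : EReal) - ((φ (x + 1) : ℝ≥0∞) : EReal)) = ⊥
  · right
    rw [hb]
    simp
  · left
    have := EReal.toReal_le_toReal h hb (EReal.coe_ne_top B)
    simpa using this

theorem psiStar_top_aux (φ : ℝ → ℝ≥0∞) (M : ℝ) (hM : 0 ≤ M)
    (hev : ∀ᶠ x : ℝ in atTop, φ x ≤ ENNReal.ofReal (M * x)) (y : ℝ) (hy : M < y) :
    psiStar φ y = ⊤ := by
  unfold psiStar erealToENNReal
  rw [if_pos]
  rw [EReal.eq_top_iff_forall_lt]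
  intro r
  obtain ⟨N, hN⟩ := eventually_atTop.1 hev
  have hpos : 0 < y - M := sub_pos.2 hy
  set x : ℝ := max (max N 0) ((r + M + 1) / (y - M)) with hxdef
  have hx0 : 0 ≤ x := le_trans (le_max_right _ _) (le_max_left _ _)
  have hxN : N ≤ x + 1 := by
    have : N ≤ x := le_trans (le_max_left _ _) (le_max_left _ _)
    linarith
  have hx2 : r + M + 1 ≤ x * (y - M) := by
    rw [← div_le_iff₀ hpos]
    exact le_max_right _ _
  have h1 : ((φ (x + 1) : ℝ≥0∞) : EReal) ≤ ((M * (x + 1) : ℝ) : EReal) := by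
    have h2 := EReal.coe_ennreal_le_coe_ennreal_iff.2 (hN _ hxN)
    rwa [EReal.coe_ennreal_ofReal, max_eq_left (by positivity)] at h2
  refine lt_of_lt_of_le ?_
    (le_iSup (fun x : ℝ => ((x * y : ℝ) : EReal) - ((φ (x + 1) : ℝ≥0∞) : EReal)) x)
  refine lt_of_lt_of_le ?_ (EReal.sub_le_sub le_rfl h1)
  rw [← EReal.coe_sub, EReal.coe_lt_coe_iff]
  nlinarith

theorem ae_bound_aux {Ω : Type*} [MeasurableSpace Ω] (φ : ℝ → ℝ≥0∞) (M : ℝ)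
    (hM : ∀ y : ℝ, M < y → psiStar φ y = ⊤) (ν : Measure Ω)
    (g : Ω → ℝ) (hg : Measurable g) (t : ℝ) (h : cgf φ ν g t ≠ ⊤) :
    ∃ L : ℝ, ∀ᵐ ω ∂ν, t * g ω ≤ L := by
  have h' : cgf φ ν g t < ⊤ := lt_top_iff_ne_top.2 h
  unfold cgf at h'
  obtain ⟨lam, hlam⟩ := iInf_lt_iff.1 h'
  refine ⟨M - lam, ?_⟩
  have hs : MeasurableSet {ω | M - lam < t * g ω} :=
    measurableSet_lt measurable_const (hg.const_mul t)
  have hle : ⊤ * ν {ω | M - lam < t * g ω} ≤ ∫⁻ ω, psiStar φ (t * g ω + lam) ∂ν := by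
    rw [← lintegral_indicator_const hs]
    refine lintegral_mono fun ω => ?_
    by_cases hω : M - lam < t * g ω
    · rw [hM _ (by linarith)]
      exact le_top
    · rw [Set.indicator_of_notMem (by simpa using hω)]
      exact zero_le
  have h0 : ν {ω | M - lam < t * g ω} = 0 := by
    by_contra hne
    rw [ENNReal.top_mul hne] at hle
    exact absurd hlam (not_lt.2 hle)
  rw [ae_iff]
  simpa using h0

/-- **Bounded functions have everywhere-finite cumulant generating function, and
conversely when `φ'(∞) < ∞`.**  (a) If `g` is `ν`-essentially bounded then
`Λ_{g,ν}(t) < ∞` for every `t`.  (b) If `φ'(∞) < ∞` and `Λ_{g,ν}` is finite on a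
neighborhood of `0`, then `g` is `ν`-essentially bounded. -/
theorem cgf_finite_bounded {Ω : Type*} [MeasurableSpace Ω] (φ : ℝ → ℝ≥0∞)
    (hconv : ∀ x y : ℝ, ∀ a b : ℝ≥0, a + b = 1 →
      φ ((a : ℝ) * x + (b : ℝ) * y) ≤ (a : ℝ≥0∞) * φ x + (b : ℝ≥0∞) * φ y)
    (hlsc : LowerSemicontinuous φ)
    (hneg : ∀ x : ℝ, x < 0 → φ x = ⊤)
    (hone : φ 1 = 0)
    (hdom : (1 : ℝ) ∈ interior {x : ℝ | φ x ≠ ⊤})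
    (dphi : ℝ≥0∞)
    (hdphi : Tendsto (fun x : ℝ => φ x / ENNReal.ofReal x) atTop (𝓝 dphi))
    (ν : Measure Ω) [IsProbabilityMeasure ν]
    (g : Ω → ℝ) (hg : Measurable g) :
    ((∃ C : ℝ, ∀ᵐ ω ∂ν, |g ω| ≤ C) → ∀ t : ℝ, cgf φ ν g t ≠ ⊤)
    ∧ (dphi ≠ ⊤ → (∃ δ : ℝ, 0 < δ ∧ ∀ t : ℝ, |t| < δ → cgf φ ν g t ≠ ⊤) →
        ∃ C : ℝ, ∀ᵐ ω ∂ν, |g ω| ≤ C) := by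
  refine ⟨?_, ?_⟩
  · rintro ⟨C, hC⟩ t
    have hle : cgf φ ν g t ≤ ENNReal.ofReal (2 * (|t| * C)) := by
      refine (iInf_le _ (-(|t| * C))).trans ?_
      calc ∫⁻ ω, psiStar φ (t * g ω + -(|t| * C)) ∂ν
          ≤ ∫⁻ _, ENNReal.ofReal (2 * (|t| * C)) ∂ν := by
            refine lintegral_mono_ae ?_
            filter_upwards [hC] with ω hω
            have h1 : |t * g ω| ≤ |t| * C := by
              rw [abs_mul]
              exact mul_le_mul_of_nonneg_left hω (abs_nonneg t)
            have h2 := abs_le.1 h1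
            exact psiStar_le_aux φ hneg _ _ (by linarith) (by linarith)
        _ = _ := by simp
    exact ne_top_of_le_ne_top ENNReal.ofReal_ne_top hle
  · rintro hd ⟨δ, hδ, hfin⟩
    have hM0 : 0 ≤ dphi.toReal + 1 := by positivity
    have hlt : dphi < ENNReal.ofReal (dphi.toReal + 1) := by
      rw [ENNReal.lt_ofReal_iff_toReal_lt hd]
      linarith
    have hev : ∀ᶠ x : ℝ in atTop, φ x ≤ ENNReal.ofReal ((dphi.toReal + 1) * x) := by
      filter_upwards [hdphi.eventually_lt_const hlt, eventually_gt_atTop 0] with x hx hx0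
      rw [ENNReal.ofReal_mul hM0]
      exact (ENNReal.div_le_iff (by simpa using hx0) ENNReal.ofReal_ne_top).1 hx.le
    have hM := psiStar_top_aux φ _ hM0 hev
    obtain ⟨L₁, h₁⟩ := ae_bound_aux φ _ hM ν g hg (δ / 2)
      (hfin _ (by rw [abs_of_pos (by linarith)]; linarith))
    obtain ⟨L₂, h₂⟩ := ae_bound_aux φ _ hM ν g hg (-(δ / 2))
      (hfin _ (by rw [abs_neg, abs_of_pos (by linarith)]; linarith))
    refine ⟨max L₁ L₂ / (δ / 2), ?_⟩
    filter_upwards [h₁, h₂] with ω a b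
    rw [le_div_iff₀ (by linarith)]
    rcases abs_cases (g ω) with ⟨h, _⟩ | ⟨h, _⟩
    · rw [h]
      exact le_trans (by linarith) (le_max_left _ _)
    · rw [h]
      exact le_trans (by linarith) (le_max_right _ _)
end
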